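/- Let L_14 = {S_14, Co(14), K_6 ∪ S_8, K_6 ∪ K_6 ∪ K_1 ∪ K_1, K_4 ∪ S_10}. The maximum number of edges of a P-free 3-graph H on 14 vertices such that H is not contained in any member of L_14 equals 39. -/

import Mathlib

/-- A 3-graph: a finite vertex set together with a finite set of edges
(intended to be 3-element subsets of the vertex set). -/
structure ThreeGraph where
  verts : Finset ℕ
  edges : Finset (Finset ℕ)

namespace ThreeGraph

/-- `G` is a genuine 3-uniform hypergraph: every edge is a 3-element subset of the vertex set. -/
def IsValid (G : ThreeGraph) : Prop :=
  ∀ e ∈ G.edges, e.card = 3 ∧ e ⊆ G.verts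

/-- `H.ContainsCopy F` means `F ⊆ H`: there is an injective map of the vertices of `F`
into those of `H` carrying every edge of `F` to an edge of `H`. -/
def ContainsCopy (H F : ThreeGraph) : Prop :=
  ∃ f : ℕ → ℕ, Set.InjOn f ↑F.verts ∧ (∀ v ∈ F.verts, f v ∈ H.verts) ∧
    ∀ e ∈ F.edges, e.image f ∈ H.edges

/-- `H.Free F` : `H` contains no copy of `F`. -/
def Free (H F : ThreeGraph) : Prop := ¬ H.ContainsCopy F

/-- `IsoCopy F H` : `H` is isomorphic to `F`. -/
def IsoCopy (F H : ThreeGraph) : Prop :=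
  ∃ f : ℕ → ℕ, Set.InjOn f ↑F.verts ∧ F.verts.image f = H.verts ∧
    F.edges.image (Finset.image f) = H.edges

/-- Connectivity: any two vertices are joined by a sequence of vertices in which
consecutive ones lie in a common edge. -/
def Connected (G : ThreeGraph) : Prop :=
  ∀ u ∈ G.verts, ∀ v ∈ G.verts,
    Relation.ReflTransGen (fun a b => ∃ e ∈ G.edges, a ∈ e ∧ b ∈ e) u v

/-- Shift all vertices by `k`. -/
def shiftBy (G : ThreeGraph) (k : ℕ) : ThreeGraph :=
  ⟨G.verts.image (· + k), G.edges.image (Finset.image (· + k))⟩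

/-- Vertex-disjoint union of two 3-graphs. -/
def dUnion (G H : ThreeGraph) : ThreeGraph :=
  ⟨G.verts ∪ (H.shiftBy (G.verts.sup id + 1)).verts,
   G.edges ∪ (H.shiftBy (G.verts.sup id + 1)).edges⟩

end ThreeGraph

/-- The loose 3-uniform path of length 3. -/
def pathP : ThreeGraph :=
  ⟨{0,1,2,3,4,5,6}, {{0,1,2},{2,3,4},{4,5,6}}⟩

/-- The triangle `C`. -/
def triangleC : ThreeGraph :=
  ⟨{0,1,2,3,4,5}, {{0,1,2},{2,3,4},{4,5,0}}⟩

/-- The matching `M`: two disjoint edges. -/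
def matchingM : ThreeGraph :=
  ⟨{0,1,2,3,4,5}, {{0,1,2},{3,4,5}}⟩

/-- `P_2`: two edges sharing exactly one vertex. -/
def pairP2 : ThreeGraph :=
  ⟨{0,1,2,3,4}, {{0,1,2},{2,3,4}}⟩

/-- The complete 3-graph `K_n`. -/
def KK (n : ℕ) : ThreeGraph :=
  ⟨Finset.range n, (Finset.range n).powersetCard 3⟩

/-- The full star `S_n` with center `0`. -/
def SS (n : ℕ) : ThreeGraph :=
  ⟨Finset.range n, ((Finset.range n).powersetCard 3).filter (fun e => 0 ∈ e)⟩

/-- `G_1(n)` with `x,y,z,v = 0,1,2,3`. -/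
def G1 (n : ℕ) : ThreeGraph :=
  ⟨Finset.range n,
   insert {0,1,2}
     (((Finset.range n).powersetCard 3).filter
       (fun h => 3 ∈ h ∧ (h ∩ ({0,1,2} : Finset ℕ)).Nonempty))⟩

/-- `G_2(n)` with `x,y,z = 0,1,2`. -/
def G2 (n : ℕ) : ThreeGraph :=
  ⟨Finset.range n,
   insert {0,1,2}
     (((Finset.range n).powersetCard 3).filter
       (fun h => (h ∩ ({0,1,2} : Finset ℕ)).card = 2))⟩

/-- `G_3(n)` with `x,y₁,y₂,z₁,z₂ = 0,1,2,3,4`. -/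
def G3 (n : ℕ) : ThreeGraph :=
  ⟨Finset.range n,
   ((({0,1,2,3,4} : Finset ℕ).powersetCard 3) \ {{1,2,3},{1,2,4}}) ∪
     ((Finset.range n \ ({0,1,2,3,4} : Finset ℕ)).biUnion (fun w => {{0,3,w},{0,4,w}}))⟩

/-- `K_5^{+t}`: `K_5` on `{0,…,4}` with `a,b = 0,1` and `t` pendant edges `{0,1,v}`. -/
def K5plus (t : ℕ) : ThreeGraph :=
  ⟨Finset.range (5 + t),
   ((Finset.range 5).powersetCard 3) ∪ ((Finset.Ico 5 (5 + t)).image (fun v => {0,1,v}))⟩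

/-- The comet `Co(n)`: a `K_4` on `{0,1,2,3}` and a full star on `{0} ∪ {4,…,n-1}`
with center `0`. -/
def comet (n : ℕ) : ThreeGraph :=
  ⟨Finset.range n,
   (({0,1,2,3} : Finset ℕ).powersetCard 3) ∪
     (((insert 0 (Finset.Ico 4 n)).powersetCard 3).filter (fun e => 0 ∈ e))⟩

/-- `W = V(H) \ U`. -/
def Wset (H : ThreeGraph) (U : Finset ℕ) : Finset ℕ := H.verts \ U

/-- `W_0`: the vertices of `W` lying in no edge of `H` entirely contained in `W`. -/
def W0set (H : ThreeGraph) (U : Finset ℕ) : Finset ℕ :=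
  (Wset H U).filter (fun v => ∀ e ∈ H.edges, e ⊆ Wset H U → v ∉ e)

/-- `W_1 = W \ W_0`. -/
def W1set (H : ThreeGraph) (U : Finset ℕ) : Finset ℕ :=
  Wset H U \ W0set H U

/-- `H_1`: the edges of `H` meeting both `U` and `W_1`. -/
def H1set (H : ThreeGraph) (U : Finset ℕ) : Finset (Finset ℕ) :=
  H.edges.filter (fun e => (e ∩ U).Nonempty ∧ (e ∩ W1set H U).Nonempty)

/-- `H[U]`: the edges of `H` entirely contained in `U`. -/
def HUset (H : ThreeGraph) (U : Finset ℕ) : Finset (Finset ℕ) :=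
  H.edges.filter (fun e => e ⊆ U)

/-- The family `L₁₄`. -/
def L14 : List ThreeGraph :=
  [SS 14, comet 14, (KK 6).dUnion (SS 8),
   (((KK 6).dUnion (KK 6)).dUnion (KK 1)).dUnion (KK 1), (KK 4).dUnion (SS 10)]

namespace TF

/-- `{a,b,c}` is an edge. -/
def Ed (H : Finset (Finset ℕ)) (a b c : ℕ) : Prop := ({a, b, c} : Finset ℕ) ∈ H

instance (H : Finset (Finset ℕ)) (a b c : ℕ) : Decidable (Ed H a b c) := by
  unfold Ed; infer_instance

theorem Ed.r213 {H : Finset (Finset ℕ)} {a b c : ℕ} (h : Ed H a b c) : Ed H b a c := by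
  unfold Ed at *; convert h using 1; ext x; simp; tauto
theorem Ed.r132 {H : Finset (Finset ℕ)} {a b c : ℕ} (h : Ed H a b c) : Ed H a c b := by
  unfold Ed at *; convert h using 1; ext x; simp; tauto
theorem Ed.r231 {H : Finset (Finset ℕ)} {a b c : ℕ} (h : Ed H a b c) : Ed H b c a := h.r213.r132
theorem Ed.r312 {H : Finset (Finset ℕ)} {a b c : ℕ} (h : Ed H a b c) : Ed H c a b := h.r132.r213
theorem Ed.r321 {H : Finset (Finset ℕ)} {a b c : ℕ} (h : Ed H a b c) : Ed H c b a := h.r231.r213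

/-- 3-uniform. -/
def Uni (H : Finset (Finset ℕ)) : Prop := ∀ e ∈ H, e.card = 3

/-- no loose path of length three -/
def PF (H : Finset (Finset ℕ)) : Prop := ∀ a b c d e f g : ℕ, [a, b, c, d, e, f, g].Nodup →
  Ed H a b c → Ed H c d e → Ed H e f g → False

/-- no loose triangle -/
def CF (H : Finset (Finset ℕ)) : Prop := ∀ a b c d e f : ℕ, [a, b, c, d, e, f].Nodup →
  Ed H a b c → Ed H c d e → Ed H e f a → False

/-- the link of every vertex has matching number at most two -/
def NF (H : Finset (Finset ℕ)) : Prop := ∀ v a b c d e f : ℕ, [v, a, b, c, d, e, f].Nodup →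
  Ed H v a b → Ed H v c d → Ed H v e f → False

theorem Uni.mono {H K : Finset (Finset ℕ)} (h : Uni H) (hK : K ⊆ H) : Uni K := fun e he => h e (hK he)
theorem PF.mono {H K : Finset (Finset ℕ)} (h : PF H) (hK : K ⊆ H) : PF K :=
  fun a b c d e f g hn h1 h2 h3 => h a b c d e f g hn (hK h1) (hK h2) (hK h3)
theorem CF.mono {H K : Finset (Finset ℕ)} (h : CF H) (hK : K ⊆ H) : CF K :=
  fun a b c d e f hn h1 h2 h3 => h a b c d e f hn (hK h1) (hK h2) (hK h3)
theorem NF.mono {H K : Finset (Finset ℕ)} (h : NF H) (hK : K ⊆ H) : NF K :=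
  fun v a b c d e f hn h1 h2 h3 => h v a b c d e f hn (hK h1) (hK h2) (hK h3)

theorem Uni.ne {H : Finset (Finset ℕ)} (h : Uni H) {a b c : ℕ} (he : Ed H a b c) :
    a ≠ b ∧ a ≠ c ∧ b ≠ c := by
  have := h _ he
  refine ⟨?_, ?_, ?_⟩ <;> rintro rfl
  · have h2 := Finset.card_le_two (a := a) (b := c); simp at this; omega
  · have h2 := Finset.card_le_two (a := a) (b := b)
    have : ({a, b, a} : Finset ℕ) = {a, b} := by ext; simp; tauto
    simp_all
  · have h2 := Finset.card_le_two (a := a) (b := b); simp at this; omega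

/-- position of a triple with respect to a set -/
theorem edge_cases (e U : Finset ℕ) (he : e.card = 3) :
    Disjoint e U ∨ (∃ x y z, x ∈ U ∧ y ∉ U ∧ z ∉ U ∧ e = {x, y, z}) ∨
    (∃ x y z, x ∈ U ∧ y ∈ U ∧ z ∉ U ∧ e = {x, y, z}) ∨ e ⊆ U := by
  obtain ⟨x, y, z, -, -, -, rfl⟩ := Finset.card_eq_three.1 he
  by_cases hx : x ∈ U <;> by_cases hy : y ∈ U <;> by_cases hz : z ∈ U
  · right; right; right; intro t; simp; rintro (rfl | rfl | rfl) <;> assumption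
  · right; right; left; exact ⟨x, y, z, hx, hy, hz, rfl⟩
  · right; right; left; exact ⟨x, z, y, hx, hz, hy, by ext; simp; tauto⟩
  · right; left; exact ⟨x, y, z, hx, hy, hz, rfl⟩
  · right; right; left; exact ⟨y, z, x, hy, hz, hx, by ext; simp; tauto⟩
  · right; left; exact ⟨y, x, z, hy, hx, hz, by ext; simp; tauto⟩
  · right; left; exact ⟨z, x, y, hz, hx, hy, by ext; simp; tauto⟩
  · left; simp [*]

/-- an edge through a given vertex -/
theorem edge_through {e : Finset ℕ} (he : e.card = 3) {x : ℕ} (hx : x ∈ e) :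
    ∃ y z, x ≠ y ∧ x ≠ z ∧ y ≠ z ∧ e = {x, y, z} := by
  have h1 : (e.erase x).card = 2 := by rw [Finset.card_erase_of_mem hx, he]
  obtain ⟨y, z, hyz, h⟩ := Finset.card_eq_two.1 h1
  have hy : y ∈ e.erase x := by simp [h]
  have hz : z ∈ e.erase x := by simp [h]
  refine ⟨y, z, ?_, ?_, hyz, ?_⟩
  · rintro rfl; simp at hy
  · rintro rfl; simp at hz
  · rw [← h, Finset.insert_erase hx]

theorem six_aux : ∀ s : Finset (Fin 6), s.card = 3 → s ∈ ({ {0,1,2},{0,1,3},{0,1,4},{0,1,5},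
    {0,2,3},{3,4,5},{0,2,4},{2,4,5},{1,4,5},{2,3,5},{1,3,5},{2,3,4},
    {0,2,5},{1,3,4},{0,3,4},{1,2,5},{0,3,5},{1,2,4},{0,4,5},{1,2,3}} : Finset (Finset (Fin 6))) := by
  decide +kernel

theorem five_aux : ∀ s : Finset (Fin 5), s.card = 3 → s ∈ ({ {0,1,2},{0,1,3},{0,1,4},
    {0,2,3},{0,2,4},{0,3,4},{1,2,3},{1,2,4},{1,3,4},{2,3,4}} : Finset (Finset (Fin 5))) := by
  decide +kernel

theorem six_list {a b c d e f : ℕ} (hn : [a, b, c, d, e, f].Nodup) {s : Finset ℕ}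
    (hs : s ⊆ {a, b, c, d, e, f}) (h3 : s.card = 3) :
    s ∈ ({ {a,b,c},{a,b,d},{a,b,e},{a,b,f},
    {a,c,d},{d,e,f},{a,c,e},{c,e,f},{b,e,f},{c,d,f},{b,d,f},{c,d,e},
    {a,c,f},{b,d,e},{a,d,e},{b,c,f},{a,d,f},{b,c,e},{a,e,f},{b,c,d}} : Finset (Finset ℕ)) := by
  have hU : ({a, b, c, d, e, f} : Finset ℕ) = Finset.univ.image ![a, b, c, d, e, f] := by
    ext x; simp [Fin.exists_fin_succ, eq_comm]
  rw [hU] at hs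
  obtain ⟨t, -, rfl⟩ := Finset.subset_image_iff.1 hs
  have ht : t.card = 3 := by
    rw [← h3, Finset.card_image_of_injective]
    intro i j hij
    simp at hn
    fin_cases i <;> fin_cases j <;> simp_all
  have := six_aux t ht
  simp only [Finset.mem_insert, Finset.mem_singleton] at this ⊢
  rcases this with rfl | rfl | rfl | rfl | rfl | rfl | rfl | rfl | rfl | rfl | rfl | rfl | rfl | rfl | rfl | rfl | rfl | rfl | rfl | rfl <;>
    simp [Finset.image_insert]

theorem five_list {a b c d e : ℕ} (hn : [a, b, c, d, e].Nodup) {s : Finset ℕ}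
    (hs : s ⊆ {a, b, c, d, e}) (h3 : s.card = 3) :
    s ∈ ({ {a,b,c},{a,b,d},{a,b,e},{a,c,d},{a,c,e},{a,d,e},{b,c,d},{b,c,e},{b,d,e},{c,d,e}} : Finset (Finset ℕ)) := by
  have hU : ({a, b, c, d, e} : Finset ℕ) = Finset.univ.image ![a, b, c, d, e] := by
    ext x; simp [Fin.exists_fin_succ, eq_comm]
  rw [hU] at hs
  obtain ⟨t, -, rfl⟩ := Finset.subset_image_iff.1 hs
  have ht : t.card = 3 := by
    rw [← h3, Finset.card_image_of_injective]
    intro i j hij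
    simp at hn
    fin_cases i <;> fin_cases j <;> simp_all
  have := five_aux t ht
  simp only [Finset.mem_insert, Finset.mem_singleton] at this ⊢
  rcases this with rfl | rfl | rfl | rfl | rfl | rfl | rfl | rfl | rfl | rfl <;>
    simp [Finset.image_insert]

theorem pair_inter {H : Finset (Finset ℕ)} {X Y : Finset ℕ} (h : X ∈ H → Y ∈ H → False) :
    (H ∩ {X, Y}).card ≤ 1 := by
  rw [Finset.card_le_one]
  intro a ha b hb
  simp at ha hb
  grind

theorem two_sets {K P Q : Finset ℕ} (hP : P ⊆ K) (hQ : Q ⊆ K)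
    (h : ∀ w ∈ P, ∀ w' ∈ Q, w = w') : P.card + Q.card ≤ max 2 K.card := by
  have h1 := Finset.card_le_card hP
  have h2 := Finset.card_le_card hQ
  rcases P.eq_empty_or_nonempty with rfl | ⟨p, hp⟩
  · simp; omega
  rcases Q.eq_empty_or_nonempty with rfl | ⟨q, hq⟩
  · simp; omega
  have : P.card ≤ 1 := Finset.card_le_one.2 fun x hx y hy => (h x hx q hq).trans (h y hy q hq).symm
  have : Q.card ≤ 1 := Finset.card_le_one.2 fun x hx y hy => (h p hp x hx).symm.trans (h p hp y hy)
  omega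

theorem three_sets {K P Q R : Finset ℕ} (hP : P ⊆ K) (hQ : Q ⊆ K) (hR : R ⊆ K)
    (h1 : ∀ w ∈ P, ∀ w' ∈ Q, w = w') (h2 : ∀ w ∈ P, ∀ w' ∈ R, w = w')
    (h3 : ∀ w ∈ Q, ∀ w' ∈ R, w = w') :
    P.card + Q.card + R.card ≤ if K.card = 0 then 0 else max 3 K.card := by
  have g1 := Finset.card_le_card hP
  have g2 := Finset.card_le_card hQ
  have g3 := Finset.card_le_card hR
  have key : ∀ A B : Finset ℕ, B.Nonempty → (∀ w ∈ A, ∀ w' ∈ B, w = w') → A.card ≤ 1 := by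
    rintro A B ⟨q, hq⟩ h
    exact Finset.card_le_one.2 fun x hx y hy => (h x hx q hq).trans (h y hy q hq).symm
  have e : ∀ A : Finset ℕ, A.card ≠ 0 → A.Nonempty := fun A h => Finset.card_pos.1 (by omega)
  have a1 := key P Q
  have a2 := key P R
  have a3 := key Q P
  have a4 := key Q R
  have a5 := key R P
  have a6 := key R Q
  by_cases p : P.card = 0 <;> by_cases q : Q.card = 0 <;> by_cases r : R.card = 0 <;>
    simp [p, q, r] <;> grind

end TF
namespace TF

theorem union_bd {A B : Finset (Finset ℕ)} {m k : ℕ} (h1 : A.card ≤ m) (h2 : B.card ≤ k) :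
    (A ∪ B).card ≤ m + k := (Finset.card_union_le _ _).trans (Nat.add_le_add h1 h2)

theorem inner12 {H : Finset (Finset ℕ)} (hU : Uni H) (hP : PF H) {a b c d e f w : ℕ}
    (hn : [a, b, c, d, e, f, w].Nodup) (hw : Ed H a b w) :
    (H.filter (fun s => s ⊆ {a, b, c, d, e, f})).card ≤ 12 := by
  have hn' : [a, b, c, d, e, f].Nodup := by
    simp at hn ⊢; grind
  have c1 : ({a,c,d} : Finset ℕ) ∈ H → ({c,e,f} : Finset ℕ) ∈ H → False := fun h1 h2 =>
    hP w b a d c e f (by simp at hn ⊢; grind) hw.r321 (Ed.r132 h1) h2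
  have c2 : ({a,c,e} : Finset ℕ) ∈ H → ({d,e,f} : Finset ℕ) ∈ H → False := fun h1 h2 =>
    hP w b a c e d f (by simp at hn ⊢; grind) hw.r321 h1 (Ed.r213 h2)
  have c3 : ({b,e,f} : Finset ℕ) ∈ H → ({c,d,f} : Finset ℕ) ∈ H → False := fun h1 h2 =>
    hP w a b e f c d (by simp at hn ⊢; grind) hw.r312 h1 (Ed.r312 h2)
  have c4 : ({b,d,f} : Finset ℕ) ∈ H → ({c,d,e} : Finset ℕ) ∈ H → False := fun h1 h2 =>
    hP w a b f d c e (by simp at hn ⊢; grind) hw.r312 (Ed.r132 h1) (Ed.r213 h2)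
  have c5 : ({a,c,f} : Finset ℕ) ∈ H → ({b,d,e} : Finset ℕ) ∈ H → False := fun h1 h2 =>
    hP c f a w b d e (by simp at hn ⊢; grind) (Ed.r231 h1) hw.r132 h2
  have c6 : ({a,d,e} : Finset ℕ) ∈ H → ({b,c,f} : Finset ℕ) ∈ H → False := fun h1 h2 =>
    hP d e a w b c f (by simp at hn ⊢; grind) (Ed.r231 h1) hw.r132 h2
  have c7 : ({a,d,f} : Finset ℕ) ∈ H → ({b,c,e} : Finset ℕ) ∈ H → False := fun h1 h2 =>
    hP d f a w b c e (by simp at hn ⊢; grind) (Ed.r231 h1) hw.r132 h2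
  have c8 : ({a,e,f} : Finset ℕ) ∈ H → ({b,c,d} : Finset ℕ) ∈ H → False := fun h1 h2 =>
    hP e f a w b c d (by simp at hn ⊢; grind) (Ed.r231 h1) hw.r132 h2
  have hsub : H.filter (fun s => s ⊆ {a, b, c, d, e, f}) ⊆
      (({{a,b,c},{a,b,d},{a,b,e},{a,b,f}} : Finset (Finset ℕ)) ∪
      ((H ∩ {{a,c,d}, {c,e,f}}) ∪ ((H ∩ {{a,c,e}, {d,e,f}}) ∪ ((H ∩ {{b,e,f}, {c,d,f}}) ∪
      ((H ∩ {{b,d,f}, {c,d,e}}) ∪ ((H ∩ {{a,c,f}, {b,d,e}}) ∪ ((H ∩ {{a,d,e}, {b,c,f}}) ∪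
      ((H ∩ {{a,d,f}, {b,c,e}}) ∪ (H ∩ {{a,e,f}, {b,c,d}}))))))))) := by
    intro s hs
    rw [Finset.mem_filter] at hs
    have := six_list hn' hs.2 (hU s hs.1)
    have hs1 := hs.1
    simp only [Finset.mem_insert, Finset.mem_singleton, Finset.mem_union, Finset.mem_inter] at this ⊢
    clear hs c1 c2 c3 c4 c5 c6 c7 c8
    rcases this with rfl | rfl | rfl | rfl | rfl | rfl | rfl | rfl | rfl | rfl | rfl | rfl | rfl | rfl | rfl | rfl | rfl | rfl | rfl | rfl <;>
      simp only [hs1, true_and, true_or, or_true]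
  refine (Finset.card_le_card hsub).trans ?_
  have h4 : ({{a,b,c},{a,b,d},{a,b,e},{a,b,f}} : Finset (Finset ℕ)).card ≤ 4 := Finset.card_le_four
  exact union_bd h4 (union_bd (pair_inter c1) (union_bd (pair_inter c2) (union_bd (pair_inter c3)
    (union_bd (pair_inter c4) (union_bd (pair_inter c5) (union_bd (pair_inter c6)
    (union_bd (pair_inter c7) (pair_inter c8))))))))

/-- a loose triangle with corners `x1 x2 x3` -/
structure Tri (H : Finset (Finset ℕ)) (x1 x2 x3 y1 y2 y3 : ℕ) : Prop where
  nd : [x1, x2, x3, y1, y2, y3].Nodup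
  e1 : Ed H x2 y1 x3
  e2 : Ed H x3 y2 x1
  e3 : Ed H x1 y3 x2

theorem Tri.rot {H x1 x2 x3 y1 y2 y3} (h : Tri H x1 x2 x3 y1 y2 y3) : Tri H x2 x3 x1 y2 y3 y1 :=
  ⟨by have := h.nd; simp at this ⊢; grind, h.e2, h.e3, h.e1⟩
theorem Tri.refl {H x1 x2 x3 y1 y2 y3} (h : Tri H x1 x2 x3 y1 y2 y3) : Tri H x2 x1 x3 y2 y1 y3 :=
  ⟨by have := h.nd; simp at this ⊢; grind, h.e2.r321, h.e1.r321, h.e3.r321⟩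

section
variable {H : Finset (Finset ℕ)} {x1 x2 x3 y1 y2 y3 w w' : ℕ}

theorem Tri.f1 (h : Tri H x1 x2 x3 y1 y2 y3) (hP : PF H) (hw : w ∉ [x1, x2, x3, y1, y2, y3])
    (hw' : w' ∉ [x1, x2, x3, y1, y2, y3]) (hww : w ≠ w') : ¬ Ed H x1 w w' := fun he =>
  hP w w' x1 y3 x2 y1 x3 (by have := h.nd; simp at this hw hw' ⊢; grind) he.r231 h.e3 h.e1
theorem Tri.f2 (h : Tri H x1 x2 x3 y1 y2 y3) (hP : PF H) (hw : w ∉ [x1, x2, x3, y1, y2, y3])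
    (hw' : w' ∉ [x1, x2, x3, y1, y2, y3]) (hww : w ≠ w') : ¬ Ed H y1 w w' := fun he =>
  hP w w' y1 x2 x3 y2 x1 (by have := h.nd; simp at this hw hw' ⊢; grind) he.r231 h.e1.r213 h.e2
theorem Tri.f3 (h : Tri H x1 x2 x3 y1 y2 y3) (hP : PF H) (hw : w ∉ [x1, x2, x3, y1, y2, y3]) :
    ¬ Ed H x1 y3 w := fun he =>
  hP w y3 x1 y2 x3 y1 x2 (by have := h.nd; simp at this hw ⊢; grind) he.r321 h.e2.r321 h.e1.r321
theorem Tri.f4 (h : Tri H x1 x2 x3 y1 y2 y3) (hP : PF H) (hw : w ∉ [x1, x2, x3, y1, y2, y3]) :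
    ¬ Ed H y1 y2 w := fun he =>
  hP w y2 y1 x3 x2 y3 x1 (by have := h.nd; simp at this hw ⊢; grind) he.r321 h.e1.r231 h.e3.r321
theorem Tri.f5 (h : Tri H x1 x2 x3 y1 y2 y3) (hP : PF H) (hw : w ∉ [x1, x2, x3, y1, y2, y3])
    (hw' : w' ∉ [x1, x2, x3, y1, y2, y3]) (ha : Ed H x1 y1 w) (hb : Ed H x2 x3 w') : w = w' := by
  by_contra hww
  exact hP w y1 x1 y3 x2 x3 w' (by have := h.nd; simp at this hw hw' ⊢; grind) ha.r321 h.e3 hb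
theorem Tri.f6 {s t : ℕ} (h : Tri H x1 x2 x3 y1 y2 y3) (hP : PF H) (hw : w ∉ [x1, x2, x3, y1, y2, y3])
    (hs : s ∉ [x1, x2, x3, y1, y2, y3]) (ht : t ∉ [x1, x2, x3, y1, y2, y3])
    (hn : [w, s, t].Nodup) (ha : Ed H x1 x2 w) (hb : Ed H w s t) : False :=
  hP s t w x2 x1 y2 x3 (by have := h.nd; simp at this hw hs ht hn ⊢; grind) hb.r231 ha.r321 h.e2.r321
theorem Tri.f7 {s t : ℕ} (h : Tri H x1 x2 x3 y1 y2 y3) (hP : PF H) (hw : w ∉ [x1, x2, x3, y1, y2, y3])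
    (hs : s ∉ [x1, x2, x3, y1, y2, y3]) (ht : t ∉ [x1, x2, x3, y1, y2, y3])
    (hn : [w, s, t].Nodup) (ha : Ed H x1 y1 w) (hb : Ed H w s t) : False :=
  hP s t w x1 y1 x2 x3 (by have := h.nd; simp at this hw hs ht hn ⊢; grind) hb.r231 ha.r312 h.e1.r213

set_option maxHeartbeats 1000000 in
/-- types of pairs -/
theorem Tri.types (h : Tri H x1 x2 x3 y1 y2 y3) (hU : Uni H) (hP : PF H) {p q : ℕ}
    (hp : p ∈ [x1, x2, x3, y1, y2, y3]) (hq : q ∈ [x1, x2, x3, y1, y2, y3])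
    (hw : w ∉ [x1, x2, x3, y1, y2, y3]) (he : Ed H p q w) :
    (Ed H x1 y1 w ∧ ({p,q,w} : Finset ℕ) = {x1,y1,w}) ∨ (Ed H x2 y2 w ∧ ({p,q,w} : Finset ℕ) = {x2,y2,w}) ∨
    (Ed H x3 y3 w ∧ ({p,q,w} : Finset ℕ) = {x3,y3,w}) ∨
    (Ed H x2 x3 w ∧ ({p,q,w} : Finset ℕ) = {x2,x3,w}) ∨ (Ed H x3 x1 w ∧ ({p,q,w} : Finset ℕ) = {x3,x1,w}) ∨
    (Ed H x1 x2 w ∧ ({p,q,w} : Finset ℕ) = {x1,x2,w}) := by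
  have hw2 : w ∉ [x2, x3, x1, y2, y3, y1] := by simp at hw ⊢; grind
  have hw3 : w ∉ [x3, x1, x2, y3, y1, y2] := by simp at hw ⊢; grind
  have hw4 : w ∉ [x2, x1, x3, y2, y1, y3] := by simp at hw ⊢; grind
  have hw5 : w ∉ [x1, x3, x2, y1, y3, y2] := by simp at hw ⊢; grind
  have hw6 : w ∉ [x3, x2, x1, y3, y2, y1] := by simp at hw ⊢; grind
  have hne := (hU.ne he).1
  have a1 := h.f3 hP hw
  have a2 := h.rot.f3 hP hw2
  have a3 := h.rot.rot.f3 hP hw3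
  have a4 := h.refl.f3 hP hw4
  have a5 := h.refl.rot.f3 hP hw5
  have a6 := h.refl.rot.rot.f3 hP hw6
  have b1 := h.f4 hP hw
  have b2 := h.rot.f4 hP hw2
  have b3 := h.rot.rot.f4 hP hw3
  have comm : ∀ x y : ℕ, ({x, y, w} : Finset ℕ) = {y, x, w} := fun x y => by ext; simp; tauto
  unfold Ed at *
  rw [comm] at b3
  simp only [List.mem_cons, List.not_mem_nil, or_false] at hp hq
  rcases hp with rfl | rfl | rfl | rfl | rfl | rfl <;> rcases hq with rfl | rfl | rfl | rfl | rfl | rfl <;>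
   first
   | exact absurd rfl hne
   | exact absurd he ‹_›
   | (rw [comm] at he; exact absurd he ‹_›)
   | simp only [he, true_and, true_or, or_true]
   | (have he' := he; rw [comm p q] at he'; have e2 := comm p q; simp only [he', e2, true_and, true_or, or_true])
end

set_option maxHeartbeats 1000000 in
/-- structure of a `P`-free graph around a triangle -/
theorem Tri.main {H : Finset (Finset ℕ)} {x1 x2 x3 y1 y2 y3 : ℕ} (h : Tri H x1 x2 x3 y1 y2 y3)
    (hU : Uni H) (hP : PF H) {S U : Finset ℕ} (hS : ∀ e ∈ H, e ⊆ S) (hUe : U = {x1, x2, x3, y1, y2, y3}) :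
    (∀ e ∈ H, e ⊆ U ∨ Disjoint e U) ∨ ∃ W ⊆ S \ U, W.Nonempty ∧ 
      H.card ≤ 12 + 3 * max 2 W.card + (H.filter (fun e => e ⊆ (S \ U) \ W)).card := by
  have memU : ∀ t, t ∈ U ↔ t ∈ [x1, x2, x3, y1, y2, y3] := by intro t; simp [hUe]
  have memU2 : ∀ t, t ∈ U ↔ t ∈ [x2, x3, x1, y2, y3, y1] := by intro t; simp [hUe]; grind
  have memU3 : ∀ t, t ∈ U ↔ t ∈ [x3, x1, x2, y3, y1, y2] := by intro t; simp [hUe]; grind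
  by_cases hcl : ∀ e ∈ H, e ⊆ U ∨ Disjoint e U
  · exact Or.inl hcl
  right
  -- edges meeting `U` in exactly one vertex do not exist
  have one : ∀ x y z, x ∈ U → y ∉ U → z ∉ U → ({x,y,z} : Finset ℕ) ∈ H → False := by
    intro x y z hx hy hz he
    have hne := (hU.ne he).2.2
    have hx' := (memU x).1 hx
    simp only [List.mem_cons, List.not_mem_nil, or_false] at hx'
    rcases hx' with rfl | rfl | rfl | rfl | rfl | rfl
    · exact h.f1 hP (by rwa [← memU]) (by rwa [← memU]) hne he
    · exact h.rot.f1 hP (by rwa [← memU2]) (by rwa [← memU2]) hne he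
    · exact h.rot.rot.f1 hP (by rwa [← memU3]) (by rwa [← memU3]) hne he
    · exact h.f2 hP (by rwa [← memU]) (by rwa [← memU]) hne he
    · exact h.rot.f2 hP (by rwa [← memU2]) (by rwa [← memU2]) hne he
    · exact h.rot.rot.f2 hP (by rwa [← memU3]) (by rwa [← memU3]) hne he
  let W := (S \ U).filter (fun w => ∃ p ∈ U, ∃ q ∈ U, Ed H p q w)
  have hWmem : ∀ w p q, p ∈ U → q ∈ U → w ∉ U → Ed H p q w → w ∈ W := by
    intro w p q hp hq hw he
    simp only [W, Finset.mem_filter, Finset.mem_sdiff]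
    exact ⟨⟨hS _ he (by simp), hw⟩, p, hp, q, hq, he⟩
  have hWU : ∀ w ∈ W, w ∉ U := by
    intro w hw; simp only [W, Finset.mem_filter, Finset.mem_sdiff] at hw; exact hw.1.2
  let T : ℕ → ℕ → Finset ℕ := fun p q => W.filter (fun w => Ed H p q w)
  have hTW : ∀ p q, T p q ⊆ W := fun p q => Finset.filter_subset _ _
  have hTm : ∀ p q w, w ∈ T p q ↔ w ∈ W ∧ Ed H p q w := fun p q w => by simp [T]
  have ux1 : x1 ∈ U := by simp [hUe]
  have ux2 : x2 ∈ U := by simp [hUe]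
  have ux3 : x3 ∈ U := by simp [hUe]
  have uy1 : y1 ∈ U := by simp [hUe]
  have uy2 : y2 ∈ U := by simp [hUe]
  have uy3 : y3 ∈ U := by simp [hUe]
  have t1 : (T x1 y1).card + (T x2 x3).card ≤ max 2 W.card := two_sets (hTW _ _) (hTW _ _) (by
    intro w hw w' hw'
    rw [hTm] at hw hw'
    exact h.f5 hP (by rw [← memU]; exact hWU _ hw.1) (by rw [← memU]; exact hWU _ hw'.1) hw.2 hw'.2)
  have t2 : (T x2 y2).card + (T x3 x1).card ≤ max 2 W.card := two_sets (hTW _ _) (hTW _ _) (by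
    intro w hw w' hw'
    rw [hTm] at hw hw'
    exact h.rot.f5 hP (by rw [← memU2]; exact hWU _ hw.1) (by rw [← memU2]; exact hWU _ hw'.1) hw.2 hw'.2)
  have t3 : (T x3 y3).card + (T x1 x2).card ≤ max 2 W.card := two_sets (hTW _ _) (hTW _ _) (by
    intro w hw w' hw'
    rw [hTm] at hw hw'
    exact h.rot.rot.f5 hP (by rw [← memU3]; exact hWU _ hw.1) (by rw [← memU3]; exact hWU _ hw'.1) hw.2 hw'.2)
  let I : ℕ → ℕ → Finset (Finset ℕ) := fun p q => (T p q).image (fun w => {p, q, w})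
  have hI : ∀ p q, (I p q).card ≤ (T p q).card := fun p q => Finset.card_image_le
  have hIm : ∀ p q w, w ∈ W → Ed H p q w → ({p, q, w} : Finset ℕ) ∈ I p q := by
    intro p q w hw he
    exact Finset.mem_image.2 ⟨w, (hTm _ _ _).2 ⟨hw, he⟩, rfl⟩
  -- `W` is nonempty
  have hWne : ∃ w p q, p ∈ U ∧ q ∈ U ∧ w ∉ U ∧ Ed H p q w := by
    push Not at hcl
    obtain ⟨e, he, h1, h2⟩ := hcl
    rcases edge_cases e U (hU e he) with h3 | ⟨x, y, z, hx, hy, hz, rfl⟩ | ⟨x, y, z, hx, hy, hz, rfl⟩ | h3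
    · exact absurd h3 h2
    · exact (one x y z hx hy hz he).elim
    · exact ⟨z, x, y, hx, hy, hz, he⟩
    · exact absurd h3 h1
  obtain ⟨w0, p0, q0, hp0, hq0, hw0, he0⟩ := hWne
  -- inner bound
  have inner : (H.filter (fun e => e ⊆ U)).card ≤ 12 := by
    have nd := h.nd
    have hw0' := hw0
    rw [memU] at hw0'
    have key : ∀ a b c d e f, U = {a, b, c, d, e, f} → [a, b, c, d, e, f, w0].Nodup → Ed H a b w0 →
        (H.filter (fun e => e ⊆ U)).card ≤ 12 := by
      intro a b c d e f hh hn he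
      rw [hh]
      exact inner12 hU hP hn he
    rcases h.types hU hP ((memU _).1 hp0) ((memU _).1 hq0) ((memU _).not.1 hw0) he0 with
      ⟨e, -⟩ | ⟨e, -⟩ | ⟨e, -⟩ | ⟨e, -⟩ | ⟨e, -⟩ | ⟨e, -⟩
    · exact key x1 y1 x2 x3 y2 y3 (by rw [hUe]; ext; simp; tauto) (by simp at nd hw0' ⊢; grind) e
    · exact key x2 y2 x1 x3 y1 y3 (by rw [hUe]; ext; simp; tauto) (by simp at nd hw0' ⊢; grind) e
    · exact key x3 y3 x1 x2 y1 y2 (by rw [hUe]; ext; simp; tauto) (by simp at nd hw0' ⊢; grind) e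
    · exact key x2 x3 x1 y1 y2 y3 (by rw [hUe]; ext; simp; tauto) (by simp at nd hw0' ⊢; grind) e
    · exact key x3 x1 x2 y1 y2 y3 (by rw [hUe]; ext; simp; tauto) (by simp at nd hw0' ⊢; grind) e
    · exact key x1 x2 x3 y1 y2 y3 hUe (by simp at nd hw0' ⊢; grind) e
  refine ⟨W, Finset.filter_subset _ _, ⟨w0, hWmem _ _ _ hp0 hq0 hw0 he0⟩, ?_⟩
  have cover : H ⊆ H.filter (fun e => e ⊆ U) ∪ (H.filter (fun e => e ⊆ (S \ U) \ W) ∪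
      ((I x1 y1 ∪ I x2 x3) ∪ ((I x2 y2 ∪ I x3 x1) ∪ (I x3 y3 ∪ I x1 x2)))) := by
    intro e he
    simp only [Finset.mem_union]
    rcases edge_cases e U (hU e he) with h3 | ⟨x, y, z, hx, hy, hz, rfl⟩ | ⟨x, y, z, hx, hy, hz, rfl⟩ | h3
    · right; left
      rw [Finset.mem_filter]
      refine ⟨he, ?_⟩
      intro w hwe
      have hwU : w ∉ U := Finset.disjoint_left.1 h3 hwe
      refine Finset.mem_sdiff.2 ⟨Finset.mem_sdiff.2 ⟨hS e he hwe, hwU⟩, ?_⟩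
      intro hwW
      simp only [W, Finset.mem_filter] at hwW
      obtain ⟨-, p, hp, q, hq, hpq⟩ := hwW
      obtain ⟨s, t, hs, ht, hst, rfl⟩ := edge_through (hU e he) hwe
      have nst : [w, s, t].Nodup := by simp; tauto
      have hsU : s ∉ U := Finset.disjoint_left.1 h3 (by simp)
      have htU : t ∉ U := Finset.disjoint_left.1 h3 (by simp)
      have hwU1 := hwU; have hsU1 := hsU; have htU1 := htU
      rw [memU] at hwU1 hsU1 htU1
      have hwU2 := hwU; have hsU2 := hsU; have htU2 := htU
      rw [memU2] at hwU2 hsU2 htU2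
      have hwU3 := hwU; have hsU3 := hsU; have htU3 := htU
      rw [memU3] at hwU3 hsU3 htU3
      rcases h.types hU hP ((memU _).1 hp) ((memU _).1 hq) hwU1 hpq with
        ⟨e, -⟩ | ⟨e, -⟩ | ⟨e, -⟩ | ⟨e, -⟩ | ⟨e, -⟩ | ⟨e, -⟩
      · exact h.f7 hP hwU1 hsU1 htU1 nst e he
      · exact h.rot.f7 hP hwU2 hsU2 htU2 nst e he
      · exact h.rot.rot.f7 hP hwU3 hsU3 htU3 nst e he
      · exact h.rot.f6 hP hwU2 hsU2 htU2 nst e he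
      · exact h.rot.rot.f6 hP hwU3 hsU3 htU3 nst e he
      · exact h.f6 hP hwU1 hsU1 htU1 nst e he
    · exact (one x y z hx hy hz he).elim
    · right; right
      have hzW := hWmem _ _ _ hx hy hz he
      rcases h.types hU hP ((memU _).1 hx) ((memU _).1 hy) ((memU _).not.1 hz) he with
        ⟨e, h2⟩ | ⟨e, h2⟩ | ⟨e, h2⟩ | ⟨e, h2⟩ | ⟨e, h2⟩ | ⟨e, h2⟩ <;>
      (rw [h2]; have := hIm _ _ _ hzW e; tauto)
    · left; exact Finset.mem_filter.2 ⟨he, h3⟩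
  have k0 := Finset.card_le_card cover
  have k1 := Finset.card_union_le (H.filter (fun e => e ⊆ U)) (H.filter (fun e => e ⊆ (S \ U) \ W) ∪
      ((I x1 y1 ∪ I x2 x3) ∪ ((I x2 y2 ∪ I x3 x1) ∪ (I x3 y3 ∪ I x1 x2))))
  have k2 := Finset.card_union_le (H.filter (fun e => e ⊆ (S \ U) \ W))
      ((I x1 y1 ∪ I x2 x3) ∪ ((I x2 y2 ∪ I x3 x1) ∪ (I x3 y3 ∪ I x1 x2)))
  have k3 := Finset.card_union_le (I x1 y1 ∪ I x2 x3) ((I x2 y2 ∪ I x3 x1) ∪ (I x3 y3 ∪ I x1 x2))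
  have k4 := Finset.card_union_le (I x2 y2 ∪ I x3 x1) (I x3 y3 ∪ I x1 x2)
  have k5 := Finset.card_union_le (I x2 y2) (I x3 x1)
  have k6 := Finset.card_union_le (I x3 y3) (I x1 x2)
  have k7 := Finset.card_union_le (I x1 y1) (I x2 x3)
  have := hI x1 y1
  have := hI x2 x3
  have := hI x2 y2
  have := hI x3 x1
  have := hI x3 y3
  have := hI x1 x2
  omega

theorem exists_tri {H : Finset (Finset ℕ)} (h : ¬ CF H) : ∃ x1 x2 x3 y1 y2 y3, Tri H x1 x2 x3 y1 y2 y3 := by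
  unfold CF at h
  push Not at h
  obtain ⟨a, b, c, d, e, f, hn, h1, h2, h3, -⟩ := h
  exact ⟨a, c, e, d, f, b, by simp at hn ⊢; grind, h2, h3, h1⟩
end TF
namespace TF

theorem filter_card_le_choose {H : Finset (Finset ℕ)} (hU : Uni H) {S : Finset ℕ} (hS : ∀ e ∈ H, e ⊆ S) :
    H.card ≤ S.card.choose 3 := by
  rw [← Finset.card_powersetCard]
  exact Finset.card_le_card fun e he => Finset.mem_powersetCard.2 ⟨hS e he, hU e he⟩

/-- graphs without two edges sharing exactly one vertex -/
theorem noP2 : ∀ (n : ℕ) {H : Finset (Finset ℕ)} (_ : Uni H)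
    (_ : ∀ v a b c d, [v, a, b, c, d].Nodup → Ed H v a b → Ed H v c d → False) {S : Finset ℕ}
    (_ : S.card ≤ n) (_ : ∀ e ∈ H, e ⊆ S), H.card ≤ S.card := by
  intro n
  induction n using Nat.strong_induction_on with
  | _ n ih =>
  intro H hU h2 S hn hS
  rcases H.eq_empty_or_nonempty with rfl | ⟨e0, he0⟩
  · simp
  obtain ⟨a, b, c, hab, hac, hbc, rfl⟩ := Finset.card_eq_three.1 (hU e0 he0)
  have habc : Ed H a b c := he0
  set U : Finset ℕ := {a, b, c} with hUe
  have hUS : U ⊆ S := hS _ he0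
  have hUc : U.card = 3 := hU _ he0
  let W := (S \ U).filter (fun w => Ed H a b w ∨ Ed H b c w ∨ Ed H c a w)
  have hW : ∀ w ∈ W, w ≠ a ∧ w ≠ b ∧ w ≠ c := by
    intro w hw
    simp [W, hUe] at hw
    tauto
  have hWS : W ⊆ S \ U := Finset.filter_subset _ _
  let T : ℕ → ℕ → Finset ℕ := fun p q => W.filter (fun w => Ed H p q w)
  have hTW : ∀ p q, T p q ⊆ W := fun p q => Finset.filter_subset _ _
  have hTm : ∀ p q w, w ∈ T p q ↔ w ∈ W ∧ Ed H p q w := fun p q w => by simp [T]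
  have t := three_sets (hTW a b) (hTW b c) (hTW c a)
    (by
      intro w hw w' hw'
      rw [hTm] at hw hw'
      by_contra hne
      have := hW _ hw.1
      have := hW _ hw'.1
      exact h2 b a w c w' (by simp; grind) hw.2.r213 hw'.2)
    (by
      intro w hw w' hw'
      rw [hTm] at hw hw'
      by_contra hne
      have := hW _ hw.1
      have := hW _ hw'.1
      exact h2 a b w c w' (by simp; grind) hw.2 hw'.2.r213)
    (by
      intro w hw w' hw'
      rw [hTm] at hw hw'
      by_contra hne
      have := hW _ hw.1
      have := hW _ hw'.1
      exact h2 c b w a w' (by simp; grind) hw.2.r213 hw'.2)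
  let I : ℕ → ℕ → Finset (Finset ℕ) := fun p q => (T p q).image (fun w => {p, q, w})
  have hI : ∀ p q, (I p q).card ≤ (T p q).card := fun p q => Finset.card_image_le
  have hIm : ∀ p q w, w ∈ W → Ed H p q w → ({p, q, w} : Finset ℕ) ∈ I p q := by
    intro p q w hw he
    exact Finset.mem_image.2 ⟨w, (hTm _ _ _).2 ⟨hw, he⟩, rfl⟩
  let H' := H.filter (fun e => e ⊆ (S \ U) \ W)
  have hrest : H'.card ≤ ((S \ U) \ W).card := by
    have hc : ((S \ U) \ W).card < n := by
      have h1 : ((S \ U) \ W).card ≤ (S \ U).card := Finset.card_le_card Finset.sdiff_subset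
      have h3 := Finset.card_sdiff_add_card_eq_card hUS
      omega
    exact ih _ hc (hU.mono (Finset.filter_subset _ _))
      (fun v a b c d hn h3 h4 => h2 v a b c d hn (Finset.filter_subset _ _ h3) (Finset.filter_subset _ _ h4)) le_rfl
      (fun e he => (Finset.mem_filter.1 he).2)
  have cover : H ⊆ {U} ∪ (H' ∪ (I a b ∪ (I b c ∪ I c a))) := by
    intro e he
    simp only [Finset.mem_union, Finset.mem_singleton]
    rcases edge_cases e U (hU e he) with h3 | ⟨x, y, z, hx, hy, hz, rfl⟩ | ⟨x, y, z, hx, hy, hz, rfl⟩ | h3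
    · right; left
      refine Finset.mem_filter.2 ⟨he, fun w hw => ?_⟩
      have hwU : w ∉ U := Finset.disjoint_left.1 h3 hw
      refine Finset.mem_sdiff.2 ⟨Finset.mem_sdiff.2 ⟨hS e he hw, hwU⟩, fun hwW => ?_⟩
      obtain ⟨s, t, hs, ht, hst, rfl⟩ := edge_through (hU e he) hw
      have hsU : s ∉ U := Finset.disjoint_left.1 h3 (by simp)
      have htU : t ∉ U := Finset.disjoint_left.1 h3 (by simp)
      simp only [W, Finset.mem_filter] at hwW
      simp [hUe] at hsU htU hwU
      rcases hwW.2 with h | h | h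
      · exact h2 w a b s t (by simp; grind) h.r312 he
      · exact h2 w b c s t (by simp; grind) h.r312 he
      · exact h2 w c a s t (by simp; grind) h.r312 he
    · exfalso
      have := (hU.ne he)
      simp [hUe] at hx hy hz
      rcases hx with rfl | rfl | rfl
      · exact h2 x y z b c (by simp; grind) he habc
      · exact h2 x y z a c (by simp; grind) he habc.r213
      · exact h2 x y z a b (by simp; grind) he habc.r312
    · right; right
      have hzS : z ∈ S \ U := Finset.mem_sdiff.2 ⟨hS _ he (by simp), hz⟩
      have key : ∀ p q, (p = a ∧ q = b ∨ p = b ∧ q = c ∨ p = c ∧ q = a) → Ed H p q z →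
          ({p, q, z} : Finset ℕ) ∈ I a b ∨ ({p, q, z} : Finset ℕ) ∈ I b c ∨ ({p, q, z} : Finset ℕ) ∈ I c a := by
        rintro p q (⟨rfl, rfl⟩ | ⟨rfl, rfl⟩ | ⟨rfl, rfl⟩) h
        · exact Or.inl (hIm _ _ _ (Finset.mem_filter.2 ⟨hzS, Or.inl h⟩) h)
        · exact Or.inr (Or.inl (hIm _ _ _ (Finset.mem_filter.2 ⟨hzS, Or.inr (Or.inl h)⟩) h))
        · exact Or.inr (Or.inr (hIm _ _ _ (Finset.mem_filter.2 ⟨hzS, Or.inr (Or.inr h)⟩) h))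
      have hne := (hU.ne he).1
      simp only [hUe, Finset.mem_insert, Finset.mem_singleton] at hx hy
      by_cases hc : (x = a ∧ y = b ∨ x = b ∧ y = c ∨ x = c ∧ y = a)
      · have := key x y hc he
        tauto
      · have := key y x (by grind) (Ed.r213 he)
        rw [Finset.insert_comm] at this
        tauto
    · left
      exact Finset.eq_of_subset_of_card_le h3 (by rw [hU e he, hUc])
  have k := Finset.card_le_card cover
  have k2 := union_bd (A := {U}) (B := (H' ∪ (I a b ∪ (I b c ∪ I c a)))) (m := 1) (by simp)
    (union_bd hrest (union_bd (hI a b) (union_bd (hI b c) (hI c a))))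
  have h3 := Finset.card_sdiff_add_card_eq_card hUS
  have h4 := Finset.card_sdiff_add_card_eq_card hWS
  split_ifs at t <;> omega
end TF
namespace TF

theorem pt {H : Finset (Finset ℕ)} (hP : PF H) (hC : CF H) {U : Finset ℕ} {p q r s t w w' : ℕ}
    (hw1 : w ∉ U) (hw2 : w' ∉ U) (hp : p ∈ U) (hq : q ∈ U) (hr : r ∈ U) (hs : s ∈ U) (ht : t ∈ U) (hnd : [p, q, r, s, t].Nodup)
    (e1 : Ed H p q w) (e2 : Ed H q r s) (e3 : Ed H s t w') : False := by
  have k : ∀ x y, x ∈ U → y ∉ U → x ≠ y := by rintro x y hx hy rfl; exact hy hx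
  have kw := fun x hx => k x w hx hw1
  have kw' := fun x hx => k x w' hx hw2
  by_cases h : w = w'
  · subst h
    exact hC w p q r s t (by simp at hnd ⊢; grind) e1.r312 e2 e3
  · exact hP w p q r s t w' (by simp at hnd ⊢; grind) e1.r312 e2 e3

set_option maxHeartbeats 2000000 in
theorem inner6 {H : Finset (Finset ℕ)} (hU : Uni H) (hP : PF H) (hC : CF H)
    {v a b c d : ℕ} (hn : [v, a, b, c, d].Nodup) (h1 : Ed H v a b) (h2 : Ed H v c d) {U : Finset ℕ}
    (hUe : U = {v, a, b, c, d})
    {w w' : ℕ} (hw : w ∉ U) (hw' : w' ∉ U) (hA : Ed H a b w ∨ Ed H v a w ∨ Ed H v b w)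
    (hB : Ed H c d w' ∨ Ed H v c w' ∨ Ed H v d w') :
    (H.filter (fun e => e ⊆ U)).card ≤ 6 := by
  have six : ∀ p q r s t u : Finset ℕ, (H.filter (fun e => e ⊆ U)) ⊆ {p, q, r, s, t, u} → (H.filter (fun e => e ⊆ U)).card ≤ 6 := by
    intro p q r s t u h
    exact (Finset.card_le_card h).trans Finset.card_le_six
  have j : ∀ e ∈ (H.filter (fun e => e ⊆ U)), e ∈ H ∧ e ∈ ({ {v,a,b},{v,a,c},{v,a,d},{v,b,c},{v,b,d},{v,c,d},{a,b,c},{a,b,d},{a,c,d},{b,c,d}} : Finset (Finset ℕ)) := by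
    intro e he
    exact ⟨(Finset.mem_filter.1 he).1, five_list hn (hUe ▸ (Finset.mem_filter.1 he).2) (hU e (Finset.mem_filter.1 he).1)⟩
  have va : v ∈ U := by simp [hUe]
  have aa : a ∈ U := by simp [hUe]
  have ba : b ∈ U := by simp [hUe]
  have ca : c ∈ U := by simp [hUe]
  have da : d ∈ U := by simp [hUe]
  have fin : ∀ p q r s t u : Finset ℕ, (∀ e ∈ H, e ∈ ({ {v,a,b},{v,a,c},{v,a,d},{v,b,c},{v,b,d},{v,c,d},{a,b,c},{a,b,d},{a,c,d},{b,c,d}} : Finset (Finset ℕ)) → e ∈ ({p,q,r,s,t,u} : Finset (Finset ℕ))) → (H.filter (fun e => e ⊆ U)).card ≤ 6 :=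
    fun p q r s t u h => six p q r s t u fun e he => h e (j e he).1 (j e he).2
  have pt0 := fun p q r s t w w' => pt hP hC (U := U) (p := p) (q := q) (r := r) (s := s) (t := t) (w := w) (w' := w')
  clear six j
  have dw : w ≠ v ∧ w ≠ a ∧ w ≠ b ∧ w ≠ c ∧ w ≠ d := by simp [hUe] at hw; tauto
  have dw' : w' ≠ v ∧ w' ≠ a ∧ w' ≠ b ∧ w' ≠ c ∧ w' ≠ d := by simp [hUe] at hw'; tauto
  clear hUe
  have vA : (Ed H v a w ∨ Ed H v b w) → ¬ Ed H a b c ∧ ¬ Ed H a b d := by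
    clear pt0 fin
    simp at hn
    rintro (hw | hw)
    · exact ⟨fun h => hC a b c d v w (by simp; grind) h h2.r231 hw.r132,
        fun h => hC a b d c v w (by simp; grind) h h2.r321 hw.r132⟩
    · exact ⟨fun h => hC b a c d v w (by simp; grind) h.r213 h2.r231 hw.r132,
        fun h => hC b a d c v w (by simp; grind) h.r213 h2.r321 hw.r132⟩
  have vB : (Ed H v c w' ∨ Ed H v d w') → ¬ Ed H a c d ∧ ¬ Ed H b c d := by
    clear pt0 fin
    simp at hn
    rintro (hw | hw)
    · exact ⟨fun h => hC c d a b v w' (by simp; grind) h.r231 h1.r231 hw.r132,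
        fun h => hC c d b a v w' (by simp; grind) h.r231 h1.r321 hw.r132⟩
    · exact ⟨fun h => hC d c a b v w' (by simp; grind) h.r321 h1.r231 hw.r132,
        fun h => hC d c b a v w' (by simp; grind) h.r321 h1.r321 hw.r132⟩
  rcases hA with hA | hA | hA <;> rcases hB with hB | hB | hB
  · have m1 : ¬ Ed H v b c := fun h => pt0 a b v c d w w' hw hw' aa ba va ca da (by clear * - hn; simp at hn ⊢; grind) hA h.r213 hB
    have m2 : ¬ Ed H v b d := fun h => pt0 a b v d c w w' hw hw' aa ba va da ca (by clear * - hn; simp at hn ⊢; grind) hA h.r213 hB.r213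
    have m3 : ¬ Ed H v a c := fun h => pt0 b a v c d w w' hw hw' ba aa va ca da (by clear * - hn; simp at hn ⊢; grind) hA.r213 h.r213 hB
    have m4 : ¬ Ed H v a d := fun h => pt0 b a v d c w w' hw hw' ba aa va da ca (by clear * - hn; simp at hn ⊢; grind) hA.r213 h.r213 hB.r213
    unfold Ed at *
    apply fin {v,a,b} {v,c,d} {a,b,c} {a,b,d} {a,c,d} {b,c,d}
    intro e he he2
    simp only [Finset.mem_insert, Finset.mem_singleton] at he2 ⊢
    rcases he2 with rfl | rfl | rfl | rfl | rfl | rfl | rfl | rfl | rfl | rfl <;> first | (exfalso; simp_all only [not_true_eq_false, and_false, false_and]; done) | simp only [true_or, or_true]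
  · obtain ⟨n3, n4⟩ := vB (by simp [hB])
    have m1 : ¬ Ed H v b d := fun h => pt0 a b d v c w w' hw hw' aa ba da va ca (by clear * - hn; simp at hn ⊢; grind) hA h.r231 hB
    have m2 : ¬ Ed H v a d := fun h => pt0 b a d v c w w' hw hw' ba aa da va ca (by clear * - hn; simp at hn ⊢; grind) hA.r213 h.r231 hB
    unfold Ed at *
    apply fin {v,a,b} {v,a,c} {v,b,c} {v,c,d} {a,b,c} {a,b,d}
    intro e he he2
    simp only [Finset.mem_insert, Finset.mem_singleton] at he2 ⊢
    rcases he2 with rfl | rfl | rfl | rfl | rfl | rfl | rfl | rfl | rfl | rfl <;> first | (exfalso; simp_all only [not_true_eq_false, and_false, false_and]; done) | simp only [true_or, or_true]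
  · obtain ⟨n3, n4⟩ := vB (by simp [hB])
    have m1 : ¬ Ed H v b c := fun h => pt0 a b c v d w w' hw hw' aa ba ca va da (by clear * - hn; simp at hn ⊢; grind) hA h.r231 hB
    have m2 : ¬ Ed H v a c := fun h => pt0 b a c v d w w' hw hw' ba aa ca va da (by clear * - hn; simp at hn ⊢; grind) hA.r213 h.r231 hB
    unfold Ed at *
    apply fin {v,a,b} {v,a,d} {v,b,d} {v,c,d} {a,b,c} {a,b,d}
    intro e he he2
    simp only [Finset.mem_insert, Finset.mem_singleton] at he2 ⊢
    rcases he2 with rfl | rfl | rfl | rfl | rfl | rfl | rfl | rfl | rfl | rfl <;> first | (exfalso; simp_all only [not_true_eq_false, and_false, false_and]; done) | simp only [true_or, or_true]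
  · obtain ⟨n1, n2⟩ := vA (by simp [hA])
    have m1 : ¬ Ed H v b c := fun h => pt0 a v b c d w w' hw hw' aa va ba ca da (by clear * - hn; simp at hn ⊢; grind) hA.r213 h hB
    have m2 : ¬ Ed H v b d := fun h => pt0 a v b d c w w' hw hw' aa va ba da ca (by clear * - hn; simp at hn ⊢; grind) hA.r213 h hB.r213
    unfold Ed at *
    apply fin {v,a,b} {v,a,c} {v,a,d} {v,c,d} {a,c,d} {b,c,d}
    intro e he he2
    simp only [Finset.mem_insert, Finset.mem_singleton] at he2 ⊢
    rcases he2 with rfl | rfl | rfl | rfl | rfl | rfl | rfl | rfl | rfl | rfl <;> first | (exfalso; simp_all only [not_true_eq_false, and_false, false_and]; done) | simp only [true_or, or_true]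
  · obtain ⟨n1, n2⟩ := vA (by simp [hA])
    obtain ⟨n3, n4⟩ := vB (by simp [hB])
    unfold Ed at *
    apply fin {v,a,b} {v,a,c} {v,a,d} {v,b,c} {v,b,d} {v,c,d}
    intro e he he2
    simp only [Finset.mem_insert, Finset.mem_singleton] at he2 ⊢
    rcases he2 with rfl | rfl | rfl | rfl | rfl | rfl | rfl | rfl | rfl | rfl <;> first | (exfalso; simp_all only [not_true_eq_false, and_false, false_and]; done) | simp only [true_or, or_true]
  · obtain ⟨n1, n2⟩ := vA (by simp [hA])
    obtain ⟨n3, n4⟩ := vB (by simp [hB])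
    unfold Ed at *
    apply fin {v,a,b} {v,a,c} {v,a,d} {v,b,c} {v,b,d} {v,c,d}
    intro e he he2
    simp only [Finset.mem_insert, Finset.mem_singleton] at he2 ⊢
    rcases he2 with rfl | rfl | rfl | rfl | rfl | rfl | rfl | rfl | rfl | rfl <;> first | (exfalso; simp_all only [not_true_eq_false, and_false, false_and]; done) | simp only [true_or, or_true]
  · obtain ⟨n1, n2⟩ := vA (by simp [hA])
    have m1 : ¬ Ed H v a c := fun h => pt0 b v a c d w w' hw hw' ba va aa ca da (by clear * - hn; simp at hn ⊢; grind) hA.r213 h hB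
    have m2 : ¬ Ed H v a d := fun h => pt0 b v a d c w w' hw hw' ba va aa da ca (by clear * - hn; simp at hn ⊢; grind) hA.r213 h hB.r213
    unfold Ed at *
    apply fin {v,a,b} {v,b,c} {v,b,d} {v,c,d} {a,c,d} {b,c,d}
    intro e he he2
    simp only [Finset.mem_insert, Finset.mem_singleton] at he2 ⊢
    rcases he2 with rfl | rfl | rfl | rfl | rfl | rfl | rfl | rfl | rfl | rfl <;> first | (exfalso; simp_all only [not_true_eq_false, and_false, false_and]; done) | simp only [true_or, or_true]
  · obtain ⟨n1, n2⟩ := vA (by simp [hA])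
    obtain ⟨n3, n4⟩ := vB (by simp [hB])
    unfold Ed at *
    apply fin {v,a,b} {v,a,c} {v,a,d} {v,b,c} {v,b,d} {v,c,d}
    intro e he he2
    simp only [Finset.mem_insert, Finset.mem_singleton] at he2 ⊢
    rcases he2 with rfl | rfl | rfl | rfl | rfl | rfl | rfl | rfl | rfl | rfl <;> first | (exfalso; simp_all only [not_true_eq_false, and_false, false_and]; done) | simp only [true_or, or_true]
  · obtain ⟨n1, n2⟩ := vA (by simp [hA])
    obtain ⟨n3, n4⟩ := vB (by simp [hB])
    unfold Ed at *
    apply fin {v,a,b} {v,a,c} {v,a,d} {v,b,c} {v,b,d} {v,c,d}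
    intro e he he2
    simp only [Finset.mem_insert, Finset.mem_singleton] at he2 ⊢
    rcases he2 with rfl | rfl | rfl | rfl | rfl | rfl | rfl | rfl | rfl | rfl <;> first | (exfalso; simp_all only [not_true_eq_false, and_false, false_and]; done) | simp only [true_or, or_true]
end TF
namespace TF

def m3 (k : ℕ) : ℕ := if k = 0 then 0 else max 3 k

set_option maxHeartbeats 2000000 in
theorem P2main {H : Finset (Finset ℕ)} (hU : Uni H) (hP : PF H) (hC : CF H) (hN : NF H) {S : Finset ℕ}
    (hS : ∀ e ∈ H, e ⊆ S) {v a b c d : ℕ} (hn : [v, a, b, c, d].Nodup) (h1 : Ed H v a b) (h2 : Ed H v c d) :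
    ∃ k, k + 5 = S.card ∧ ∃ Z : Finset ℕ, Z.card ≤ k ∧
      (H.card ≤ 10 + m3 k + (H.filter (fun e => e ⊆ Z)).card ∨
       H.card ≤ 6 + Z.card + 2 * m3 (k - Z.card) + (H.filter (fun e => e ⊆ Z)).card) := by
  obtain ⟨U, hUe⟩ : ∃ U : Finset ℕ, U = {v, a, b, c, d} := ⟨_, rfl⟩
  have hUS : U ⊆ S := by
    have g1 := hS _ h1
    have g2 := hS _ h2
    intro x hx
    simp [hUe] at hx
    rcases hx with rfl | rfl | rfl | rfl | rfl
    · exact g1 (by simp)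
    · exact g1 (by simp)
    · exact g1 (by simp)
    · exact g2 (by simp)
    · exact g2 (by simp)
  have hUc : U.card = 5 := by
    rw [hUe]
    have := List.toFinset_card_of_nodup hn
    simpa using this
  simp at hn
  obtain ⟨W, hWe⟩ : ∃ W, W = S \ U := ⟨_, rfl⟩
  have hWU : ∀ w ∈ W, w ≠ v ∧ w ≠ a ∧ w ≠ b ∧ w ≠ c ∧ w ≠ d := by
    intro w hw
    simp [hWe, hUe] at hw
    tauto
  have hWc := Finset.card_sdiff_add_card_eq_card hUS
  rw [← hWe] at hWc
  obtain ⟨T, hTm⟩ : ∃ T : ℕ → ℕ → Finset ℕ, ∀ p q w, w ∈ T p q ↔ w ∈ W ∧ Ed H p q w :=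
    ⟨fun p q => W.filter (fun w => Ed H p q w), by simp⟩
  have hTW : ∀ p q, T p q ⊆ W := fun p q w hw => ((hTm p q w).1 hw).1
  -- conflicts
  have cA : ∀ w ∈ T a b, ∀ w' ∈ T v a, w = w' := by
    intro w hw w' hw'
    rw [hTm] at hw hw'
    by_contra hne
    have := hWU _ hw.1
    have := hWU _ hw'.1
    exact hP w b a w' v c d (by simp; grind) hw.2.r321 hw'.2.r231 h2
  have cB : ∀ w ∈ T a b, ∀ w' ∈ T v b, w = w' := by
    intro w hw w' hw'
    rw [hTm] at hw hw'
    by_contra hne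
    have := hWU _ hw.1
    have := hWU _ hw'.1
    exact hP w a b w' v c d (by simp; grind) hw.2.r312 hw'.2.r231 h2
  have cC : ∀ w ∈ T v a, ∀ w' ∈ T v b, w = w' := by
    intro w hw w' hw'
    rw [hTm] at hw hw'
    by_contra hne
    have := hWU _ hw.1
    have := hWU _ hw'.1
    exact hN v a w b w' c d (by simp; grind) hw.2 hw'.2 h2
  have cA' : ∀ w ∈ T c d, ∀ w' ∈ T v c, w = w' := by
    intro w hw w' hw'
    rw [hTm] at hw hw'
    by_contra hne
    have := hWU _ hw.1
    have := hWU _ hw'.1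
    exact hP w d c w' v a b (by simp; grind) hw.2.r321 hw'.2.r231 h1
  have cB' : ∀ w ∈ T c d, ∀ w' ∈ T v d, w = w' := by
    intro w hw w' hw'
    rw [hTm] at hw hw'
    by_contra hne
    have := hWU _ hw.1
    have := hWU _ hw'.1
    exact hP w c d w' v a b (by simp; grind) hw.2.r312 hw'.2.r231 h1
  have cC' : ∀ w ∈ T v c, ∀ w' ∈ T v d, w = w' := by
    intro w hw w' hw'
    rw [hTm] at hw hw'
    by_contra hne
    have := hWU _ hw.1
    have := hWU _ hw'.1
    exact hN v c w d w' a b (by simp; grind) hw.2 hw'.2 h1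
  have xx : ∀ p q r s z, z ∈ W → (p = a ∧ r = b ∨ p = b ∧ r = a) → (q = c ∧ s = d ∨ q = d ∧ s = c) → Ed H p q z → False := by
    intro p q r s z hz hp hq h
    have := hWU z hz
    clear cA cB cC cA' cB' cC' hTm hTW hWc hWU hUS hUc hz
    rcases hp with ⟨rfl, rfl⟩ | ⟨rfl, rfl⟩ <;> rcases hq with ⟨rfl, rfl⟩ | ⟨rfl, rfl⟩
    · exact hC p z q s v r (by simp; grind) h.r132 h2.r231 h1.r132
    · exact hC p z q s v r (by simp; grind) h.r132 h2.r321 h1.r132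
    · exact hC p z q s v r (by simp; grind) h.r132 h2.r231 h1
    · exact hC p z q s v r (by simp; grind) h.r132 h2.r321 h1
  let I : ℕ → ℕ → Finset (Finset ℕ) := fun p q => (T p q).image (fun w => {p, q, w})
  have hI : ∀ p q, (I p q).card ≤ (T p q).card := fun p q => Finset.card_image_le
  have hIm : ∀ p q w, w ∈ W → Ed H p q w → ({p, q, w} : Finset ℕ) ∈ I p q := by
    intro p q w hw he
    exact Finset.mem_image.2 ⟨w, (hTm _ _ _).2 ⟨hw, he⟩, rfl⟩
  obtain ⟨D, hD⟩ : ∃ D, D = H.filter (fun e => Disjoint e U) := ⟨_, rfl⟩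
  obtain ⟨Z, hZ⟩ : ∃ Z : Finset ℕ, Z = D.biUnion id := ⟨_, rfl⟩
  have hZW : Z ⊆ W := by
    intro w hw
    simp only [hZ, Finset.mem_biUnion, id] at hw
    obtain ⟨e, he, hwe⟩ := hw
    rw [hD, Finset.mem_filter] at he
    exact hWe ▸ Finset.mem_sdiff.2 ⟨hS e he.1 hwe, Finset.disjoint_left.1 he.2 hwe⟩
  have hZc := Finset.card_le_card hZW
  have hDZ : D.card ≤ (H.filter (fun e => e ⊆ Z)).card := by
    apply Finset.card_le_card
    intro e he
    rw [Finset.mem_filter]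
    refine ⟨(Finset.mem_filter.1 (hD ▸ he)).1, ?_⟩
    rw [hZ]
    exact Finset.subset_biUnion_of_mem id he
  have hZe : ∀ w ∈ Z, ∃ s t, Ed H w s t ∧ w ≠ s ∧ w ≠ t ∧ s ≠ t ∧ s ∉ U ∧ t ∉ U ∧ w ∉ U := by
    intro w hw
    simp only [hZ, Finset.mem_biUnion, id] at hw
    obtain ⟨e, he, hwe⟩ := hw
    rw [hD, Finset.mem_filter] at he
    obtain ⟨s, t, k1, k2, k3, rfl⟩ := edge_through (hU e he.1) hwe
    exact ⟨s, t, he.1, k1, k2, k3, Finset.disjoint_left.1 he.2 (by simp),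
      Finset.disjoint_left.1 he.2 (by simp), Finset.disjoint_left.1 he.2 hwe⟩
  obtain ⟨J, hJ⟩ : ∃ J, J = H.filter (fun e => e ⊆ U) := ⟨_, rfl⟩
  have cover : H ⊆ J ∪ (D ∪ ((I a b ∪ (I v a ∪ I v b)) ∪ (I c d ∪ (I v c ∪ I v d)))) := by
    intro e he
    simp only [Finset.mem_union]
    rcases edge_cases e U (hU e he) with h3 | ⟨x, y, z, hx, hy, hz, rfl⟩ | ⟨x, y, z, hx, hy, hz, rfl⟩ | h3
    · right; left
      rw [hD]
      exact Finset.mem_filter.2 ⟨he, h3⟩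
    · exfalso
      have := (hU.ne he)
      simp [hUe] at hx hy hz
      rcases hx with rfl | rfl | rfl | rfl | rfl
      · exact hN x a b c d y z (by simp; grind) h1 h2 he
      · exact hP y z x b v c d (by simp; grind) (Ed.r231 he) h1.r231 h2
      · exact hP y z x a v c d (by simp; grind) (Ed.r231 he) h1.r321 h2
      · exact hP y z x d v a b (by simp; grind) (Ed.r231 he) h2.r231 h1
      · exact hP y z x c v a b (by simp; grind) (Ed.r231 he) h2.r321 h1
    · right; right
      have hzS : z ∈ W := hWe ▸ Finset.mem_sdiff.2 ⟨hS _ he (by simp), hz⟩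
      have := hWU _ hzS
      have key : ∀ p q, (p = a ∧ q = b ∨ p = v ∧ q = a ∨ p = v ∧ q = b ∨ p = c ∧ q = d ∨ p = v ∧ q = c ∨ p = v ∧ q = d) → Ed H p q z →
          (({p, q, z} : Finset ℕ) ∈ I a b ∨ ({p, q, z} : Finset ℕ) ∈ I v a ∨ ({p, q, z} : Finset ℕ) ∈ I v b) ∨
          ({p, q, z} : Finset ℕ) ∈ I c d ∨ ({p, q, z} : Finset ℕ) ∈ I v c ∨ ({p, q, z} : Finset ℕ) ∈ I v d := by
        intro p q hpq h
        have hs1 := hIm p q z hzS h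
        rcases hpq with (⟨rfl, rfl⟩ | ⟨rfl, rfl⟩ | ⟨rfl, rfl⟩ | ⟨rfl, rfl⟩ | ⟨rfl, rfl⟩ | ⟨rfl, rfl⟩) <;>
          simp only [hs1, true_or, or_true]
      have hne := (hU.ne he).1
      clear cA cB cC cA' cB' cC' hTm hTW hWc hWU hUS hUc hIm hI hZe hDZ hZc hZW
      simp only [hUe, Finset.mem_insert, Finset.mem_singleton] at hx hy
      by_cases hc : (x = a ∧ y = b ∨ x = v ∧ y = a ∨ x = v ∧ y = b ∨ x = c ∧ y = d ∨ x = v ∧ y = c ∨ x = v ∧ y = d)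
      · exact key x y hc he
      · by_cases hc2 : (y = a ∧ x = b ∨ y = v ∧ x = a ∨ y = v ∧ x = b ∨ y = c ∧ x = d ∨ y = v ∧ x = c ∨ y = v ∧ x = d)
        · have := key y x hc2 (Ed.r213 he)
          rw [Finset.insert_comm] at this
          exact this
        · exfalso
          by_cases hxa : x = a
          · by_cases hyc : y = c
            · exact xx x y b d z hzS (by grind) (by grind) he
            · exact xx x y b c z hzS (by grind) (by grind) he
          by_cases hxb : x = b
          · by_cases hyc : y = c
            · exact xx x y a d z hzS (by grind) (by grind) he
            · exact xx x y a c z hzS (by grind) (by grind) he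
          by_cases hya : y = a
          · by_cases hyc : x = c
            · exact xx y x b d z hzS (by grind) (by grind) (Ed.r213 he)
            · exact xx y x b c z hzS (by grind) (by grind) (Ed.r213 he)
          by_cases hyc : x = c
          · exact xx y x a d z hzS (by grind) (by grind) (Ed.r213 he)
          · exact xx y x a c z hzS (by grind) (by grind) (Ed.r213 he)
    · left
      rw [hJ]
      exact Finset.mem_filter.2 ⟨he, h3⟩
  have kc := Finset.card_le_card cover
  have inner10 : J.card ≤ 10 := by
    have := filter_card_le_choose (H := J) (hU.mono (hJ ▸ Finset.filter_subset _ _)) (S := U) (fun e he => by rw [hJ] at he; exact (Finset.mem_filter.1 he).2)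
    rw [hUc] at this
    exact this
  refine ⟨W.card, by omega, Z, hZc, ?_⟩
  by_cases hAe : T a b = ∅ ∧ T v a = ∅ ∧ T v b = ∅
  · left
    have t := three_sets (hTW c d) (hTW v c) (hTW v d) cA' cB' cC'
    have i1 : I a b = ∅ := by simp [I, hAe.1]
    have i2 : I v a = ∅ := by simp [I, hAe.2.1]
    have i3 : I v b = ∅ := by simp [I, hAe.2.2]
    rw [i1, i2, i3] at kc
    simp only [Finset.empty_union] at kc
    have := union_bd inner10 (union_bd hDZ (union_bd (hI c d) (union_bd (hI v c) (hI v d))))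
    unfold m3
    omega
  by_cases hBe : T c d = ∅ ∧ T v c = ∅ ∧ T v d = ∅
  · left
    have t := three_sets (hTW a b) (hTW v a) (hTW v b) cA cB cC
    have i1 : I c d = ∅ := by simp [I, hBe.1]
    have i2 : I v c = ∅ := by simp [I, hBe.2.1]
    have i3 : I v d = ∅ := by simp [I, hBe.2.2]
    rw [i1, i2, i3] at kc
    simp only [Finset.union_empty] at kc
    have := union_bd inner10 (union_bd hDZ (union_bd (hI a b) (union_bd (hI v a) (hI v b))))
    unfold m3
    omega
  right
  have va : v ∈ U := by simp [hUe]
  have aa : a ∈ U := by simp [hUe]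
  have ba : b ∈ U := by simp [hUe]
  have ca : c ∈ U := by simp [hUe]
  have da : d ∈ U := by simp [hUe]
  have nD : [v, a, b, c, d].Nodup := by simp; grind
  have inner6 : J.card ≤ 6 := by
    have hA : ∃ w, w ∉ U ∧ (Ed H a b w ∨ Ed H v a w ∨ Ed H v b w) := by
      by_contra! h
      apply hAe
      refine ⟨?_, ?_, ?_⟩ <;> apply Finset.eq_empty_of_forall_notMem <;> intro w hw <;> rw [hTm] at hw <;>
        have := h w (by have := hw.1; rw [hWe] at this; exact (Finset.mem_sdiff.1 this).2) <;> tauto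
    have hB : ∃ w, w ∉ U ∧ (Ed H c d w ∨ Ed H v c w ∨ Ed H v d w) := by
      by_contra! h
      apply hBe
      refine ⟨?_, ?_, ?_⟩ <;> apply Finset.eq_empty_of_forall_notMem <;> intro w hw <;> rw [hTm] at hw <;>
        have := h w (by have := hw.1; rw [hWe] at this; exact (Finset.mem_sdiff.1 this).2) <;> tauto
    obtain ⟨w, hw, hA⟩ := hA
    obtain ⟨w', hw', hB⟩ := hB
    rw [hJ]
    exact TF.inner6 hU hP hC nD h1 h2 hUe hw hw' hA hB
  -- vertices in Z
  have hU' : ∀ x, x ∉ U → x ≠ v ∧ x ≠ a ∧ x ≠ b ∧ x ≠ c ∧ x ≠ d := by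
    intro x hx; simp [hUe] at hx; tauto
  have z1 : ∀ w ∈ Z, w ∉ T v a ∧ w ∉ T v b ∧ w ∉ T v c ∧ w ∉ T v d ∧ ¬ (w ∈ T a b ∧ w ∈ T c d) := by
    intro w hw
    obtain ⟨s, t, k1, k2, k3, k4, k5, k6, k7⟩ := hZe w hw
    have := hU' _ k5
    have := hU' _ k6
    have := hU' _ k7
    simp only [hTm]
    refine ⟨?_, ?_, ?_, ?_, ?_⟩
    · rintro ⟨-, h⟩; exact hP s t w a v c d (by simp; grind) k1.r231 h.r321 h2
    · rintro ⟨-, h⟩; exact hP s t w b v c d (by simp; grind) k1.r231 h.r321 h2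
    · rintro ⟨-, h⟩; exact hP s t w c v a b (by simp; grind) k1.r231 h.r321 h1
    · rintro ⟨-, h⟩; exact hP s t w d v a b (by simp; grind) k1.r231 h.r321 h1
    · rintro ⟨⟨-, h⟩, -, h'⟩; exact hN w a b c d s t (by simp; grind) h.r312 h'.r312 k1
  have sub : ∀ p q, (∀ w ∈ Z, w ∉ T p q) → T p q ⊆ W \ Z := fun p q h w hw =>
    Finset.mem_sdiff.2 ⟨hTW _ _ hw, fun hz => h w hz hw⟩
  have t1 := three_sets (K := W \ Z) (P := T a b \ Z) (Finset.sdiff_subset_sdiff (hTW a b) subset_rfl)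
    (sub v a fun w hw => (z1 w hw).1) (sub v b fun w hw => (z1 w hw).2.1)
    (fun w hw => cA w (Finset.mem_sdiff.1 hw).1) (fun w hw => cB w (Finset.mem_sdiff.1 hw).1) cC
  have t2 := three_sets (K := W \ Z) (P := T c d \ Z) (Finset.sdiff_subset_sdiff (hTW c d) subset_rfl)
    (sub v c fun w hw => (z1 w hw).2.2.1) (sub v d fun w hw => (z1 w hw).2.2.2.1)
    (fun w hw => cA' w (Finset.mem_sdiff.1 hw).1) (fun w hw => cB' w (Finset.mem_sdiff.1 hw).1) cC'
  have s1 := Finset.card_sdiff_add_card_inter (T a b) Z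
  have s2 := Finset.card_sdiff_add_card_inter (T c d) Z
  have s3 : (T a b ∩ Z).card + (T c d ∩ Z).card ≤ Z.card := by
    rw [← Finset.card_union_of_disjoint]
    · exact Finset.card_le_card (Finset.union_subset Finset.inter_subset_right Finset.inter_subset_right)
    · rw [Finset.disjoint_left]
      intro w hw hw'
      rw [Finset.mem_inter] at hw hw'
      exact (z1 w hw.2).2.2.2.2 ⟨hw.1, hw'.1⟩
  have s4 := Finset.card_sdiff_of_subset hZW
  rw [s4] at t1 t2
  have := union_bd inner6 (union_bd hDZ (union_bd (union_bd (hI a b) (union_bd (hI v a) (hI v b))) (union_bd (hI c d) (union_bd (hI v c) (hI v d)))))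
  unfold m3
  omega
end TF
namespace TF

theorem P2alt {H : Finset (Finset ℕ)} (hU : Uni H) (hP : PF H) (hC : CF H) (hN : NF H) {S : Finset ℕ}
    (hS : ∀ e ∈ H, e ⊆ S) : H.card ≤ S.card ∨
    ∃ k, k + 5 = S.card ∧ ∃ Z : Finset ℕ, Z.card ≤ k ∧
      (H.card ≤ 10 + m3 k + (H.filter (fun e => e ⊆ Z)).card ∨
       H.card ≤ 6 + Z.card + 2 * m3 (k - Z.card) + (H.filter (fun e => e ⊆ Z)).card) := by
  by_cases h : ∀ v a b c d, [v, a, b, c, d].Nodup → Ed H v a b → Ed H v c d → False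
  · exact Or.inl (noP2 _ hU h le_rfl hS)
  · push Not at h
    obtain ⟨v, a, b, c, d, hn, h1, h2, -⟩ := h
    exact Or.inr (P2main hU hP hC hN hS hn h1 h2)

theorem filt_choose {H : Finset (Finset ℕ)} (hU : Uni H) (Z : Finset ℕ) :
    (H.filter (fun e => e ⊆ Z)).card ≤ Z.card.choose 3 :=
  filter_card_le_choose (hU.mono (Finset.filter_subset _ _)) (fun e he => (Finset.mem_filter.1 he).2)

theorem q_small {H : Finset (Finset ℕ)} (hU : Uni H) (hP : PF H) (hC : CF H) (hN : NF H) {S : Finset ℕ}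
    (hS : ∀ e ∈ H, e ⊆ S) : (S.card ≤ 7 → H.card ≤ 13) ∧ (S.card ≤ 8 → H.card ≤ 14) ∧ (S.card ≤ 9 → H.card ≤ 18) := by
  have h5 := filter_card_le_choose hU hS
  rcases P2alt hU hP hC hN hS with h | ⟨k, hk, Z, hZ, h⟩
  · omega
  · have hc := filt_choose hU Z
    rw [← hk]
    by_cases hk4 : k ≤ 4
    · obtain ⟨z, hz⟩ : ∃ z, Z.card = z := ⟨_, rfl⟩
      rw [hz] at hZ h hc
      unfold m3 at h
      generalize (H.filter (fun e => e ⊆ Z)).card = x at *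
      interval_cases k <;> interval_cases z <;> simp [Nat.choose] at hc h ⊢ <;> omega
    · omega

theorem q14 {H : Finset (Finset ℕ)} (hU : Uni H) (hP : PF H) (hC : CF H) (hN : NF H) {S : Finset ℕ}
    (hS : ∀ e ∈ H, e ⊆ S) (h14 : S.card = 14) : H.card ≤ 39 := by
  rcases P2alt hU hP hC hN hS with h | ⟨k, hk, Z, hZ, h⟩
  · omega
  · have hc := filt_choose hU Z
    have hf := Finset.filter_subset (fun e => e ⊆ Z) H
    have hq := q_small (hU.mono hf) (hP.mono hf) (hC.mono hf) (hN.mono hf) (S := Z)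
      (fun e he => (Finset.mem_filter.1 he).2)
    obtain rfl : k = 9 := by omega
    obtain ⟨z, hz⟩ : ∃ z, Z.card = z := ⟨_, rfl⟩
    rw [hz] at hZ h hc hq
    unfold m3 at h
    generalize (H.filter (fun e => e ⊆ Z)).card = x at *
    interval_cases z <;> simp [Nat.choose] at hc h hq ⊢ <;> omega
end TF
namespace TF

theorem link_count {G L : Finset (Finset ℕ)} {Y : Finset ℕ} (hG : ∀ g ∈ G, g.card = 3 ∧ g ⊆ Y)
    (hL : ∀ l ∈ L, l.card = 2 ∧ l ⊆ Y) (hY : ∀ y ∈ Y, ∃ g ∈ G, y ∈ g)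
    (hM : ∀ l ∈ L, ∀ g ∈ G, Disjoint l g ∨ l ⊆ g) :
    ∃ p, ∃ R : Finset ℕ, 2 * p + R.card = Y.card ∧
      (∀ M ⊆ L, (M : Set (Finset ℕ)).PairwiseDisjoint id → M.card ≤ p) ∧
      G.card + L.card ≤ p * max (R.card + 1) 4 + (G.filter (fun e => e ⊆ R)).card := by
  classical
  let F := L.powerset.filter (fun M : Finset (Finset ℕ) => (M : Set (Finset ℕ)).PairwiseDisjoint id)
  have hF : F.Nonempty := ⟨∅, by simp [F]⟩
  obtain ⟨M, hMF, hmax⟩ := Finset.exists_max_image F Finset.card hF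
  have hML : M ⊆ L := by have := (Finset.mem_filter.1 hMF).1; simpa using this
  have hMd : (M : Set (Finset ℕ)).PairwiseDisjoint id := (Finset.mem_filter.1 hMF).2
  have hmax' : ∀ M' ⊆ L, (M' : Set (Finset ℕ)).PairwiseDisjoint id → M'.card ≤ M.card := fun M' h1 h2 =>
    hmax M' (Finset.mem_filter.2 ⟨Finset.mem_powerset.2 h1, h2⟩)
  obtain ⟨X, hX⟩ : ∃ X, X = M.biUnion id := ⟨_, rfl⟩
  have hXY : X ⊆ Y := by
    rw [hX]; exact Finset.biUnion_subset.2 fun m hm => (hL m (hML hm)).2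
  have hXc : X.card = 2 * M.card := by
    rw [hX, Finset.card_biUnion hMd, Finset.sum_const_nat (m := 2)]
    · ring
    · intro m hm; exact (hL m (hML hm)).1
  obtain ⟨R, hR⟩ : ∃ R, R = Y \ X := ⟨_, rfl⟩
  have hRc := Finset.card_sdiff_add_card_eq_card hXY
  rw [← hR] at hRc
  refine ⟨M.card, R, by omega, hmax', ?_⟩
  -- every l meets some m
  have meet : ∀ l ∈ L, ∃ m ∈ M, ¬ Disjoint l m := by
    intro l hl
    by_contra! h
    have hlM : l ∉ M := by
      intro hlm
      have h1 := h l hlm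
      rw [disjoint_self] at h1
      have := (hL l hl).1
      rw [h1] at this
      simp at this
    have := hmax' (insert l M) (Finset.insert_subset hl hML) (by
      rw [Finset.coe_insert]
      exact hMd.insert fun j hj _ => h j hj)
    rw [Finset.card_insert_of_notMem hlM] at this
    omega
  let Gm : Finset ℕ → Finset (Finset ℕ) := fun m => G.filter (fun g => m ⊆ g)
  let Lm : Finset ℕ → Finset (Finset ℕ) := fun m => L.filter (fun l => ¬ Disjoint l m)
  have c1 : G ⊆ M.biUnion Gm ∪ G.filter (fun e => e ⊆ R) := by
    intro g hg
    by_cases h : ∃ m ∈ M, m ⊆ g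
    · obtain ⟨m, hm, hmg⟩ := h
      exact Finset.mem_union_left _ (Finset.mem_biUnion.2 ⟨m, hm, Finset.mem_filter.2 ⟨hg, hmg⟩⟩)
    · apply Finset.mem_union_right
      refine Finset.mem_filter.2 ⟨hg, fun x hx => ?_⟩
      rw [hR, Finset.mem_sdiff]
      refine ⟨(hG g hg).2 hx, fun hxX => ?_⟩
      rw [hX, Finset.mem_biUnion] at hxX
      obtain ⟨m, hm, hxm⟩ := hxX
      rcases hM m (hML hm) g hg with h1 | h1
      · exact Finset.disjoint_left.1 h1 hxm hx
      · exact h ⟨m, hm, h1⟩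
  have c2 : L ⊆ M.biUnion Lm := by
    intro l hl
    obtain ⟨m, hm, h⟩ := meet l hl
    exact Finset.mem_biUnion.2 ⟨m, hm, Finset.mem_filter.2 ⟨hl, h⟩⟩
  have bd : ∀ m ∈ M, (Gm m).card + (Lm m).card ≤ max (R.card + 1) 4 := by
    intro m hm
    have hm2 := hL m (hML hm)
    -- third vertices
    have g1 : (Gm m).card ≤ R.card := by
      have : Gm m ⊆ R.image (fun t => insert t m) := by
        intro g hg
        obtain ⟨hg, hmg⟩ := Finset.mem_filter.1 hg
        have h1 : (g \ m).card = 1 := by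
          have := Finset.card_sdiff_add_card_eq_card hmg
          have := (hG g hg).1
          omega
        obtain ⟨t, ht⟩ := Finset.card_eq_one.1 h1
        have htg : t ∈ g \ m := by rw [ht]; simp
        rw [Finset.mem_sdiff] at htg
        refine Finset.mem_image.2 ⟨t, ?_, ?_⟩
        · rw [hR, Finset.mem_sdiff]
          refine ⟨(hG g hg).2 htg.1, fun htX => ?_⟩
          rw [hX, Finset.mem_biUnion] at htX
          obtain ⟨m', hm', htm'⟩ := htX
          have hne : m' ≠ m := by rintro rfl; exact htg.2 htm'
          have hd : Disjoint m' m := hMd hm' hm hne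
          rcases hM m' (hML hm') g hg with h2 | h2
          · exact Finset.disjoint_left.1 h2 htm' htg.1
          · have := Finset.card_le_card (Finset.union_subset h2 hmg)
            rw [Finset.card_union_of_disjoint hd, hm2.1, (hL m' (hML hm')).1, (hG g hg).1] at this
            omega
        · rw [Finset.insert_eq, ← ht, Finset.sdiff_union_of_subset hmg]
      exact (Finset.card_le_card this).trans Finset.card_image_le
    have lg : ∀ l ∈ Lm m, ∀ g ∈ Gm m, l ⊆ g := by
      intro l hl g hg
      obtain ⟨hl, hlm⟩ := Finset.mem_filter.1 hl
      obtain ⟨hg, hmg⟩ := Finset.mem_filter.1 hg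
      rcases hM l hl g hg with h | h
      · exact absurd (Finset.disjoint_of_subset_right hmg h) hlm
      · exact h
    have lc : ∀ l ∈ Lm m, l.card = 2 := fun l hl => (hL l (Finset.mem_filter.1 hl).1).1
    obtain ⟨x, hx⟩ : m.Nonempty := Finset.card_pos.1 (by omega)
    obtain ⟨g, hg, hxg⟩ := hY x (hm2.2 hx)
    have hgm : g ∈ Gm m := by
      refine Finset.mem_filter.2 ⟨hg, ?_⟩
      rcases hM m (hML hm) g hg with h | h
      · exact absurd hxg (Finset.disjoint_left.1 h hx)
      · exact h
    by_cases h2 : ∃ g' ∈ Gm m, g' ≠ g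
    · obtain ⟨g', hg', hne⟩ := h2
      have : Lm m ⊆ {m} := by
        intro l hl
        rw [Finset.mem_singleton]
        have h3 : m ⊆ g ∩ g' := Finset.subset_inter (Finset.mem_filter.1 hgm).2 (Finset.mem_filter.1 hg').2
        have h4 : l ⊆ g ∩ g' := Finset.subset_inter (lg l hl g hgm) (lg l hl g' hg')
        have h5 : (g ∩ g').card ≤ 2 := by
          by_contra h6
          have h7 : g ∩ g' = g := Finset.eq_of_subset_of_card_le Finset.inter_subset_left (by
            have := (hG g hg).1
            omega)
          have h8 : g ∩ g' = g' := Finset.eq_of_subset_of_card_le Finset.inter_subset_right (by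
            have := (hG g' (Finset.mem_filter.1 hg').1).1
            omega)
          exact hne (h8.symm.trans h7)
        have e1 := Finset.eq_of_subset_of_card_le h3 (by omega)
        have e2 := Finset.eq_of_subset_of_card_le h4 (by have := lc l hl; omega)
        exact e2.trans e1.symm
      have := Finset.card_le_card this
      simp at this
      omega
    · push Not at h2
      have a1 : (Gm m).card ≤ 1 := Finset.card_le_one.2 fun p hp q hq => (h2 p hp).trans (h2 q hq).symm
      have a2 : Lm m ⊆ g.powersetCard 2 := fun l hl => Finset.mem_powersetCard.2 ⟨lg l hl g hgm, lc l hl⟩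
      have a3 := Finset.card_le_card a2
      rw [Finset.card_powersetCard, (hG g hg).1] at a3
      have : Nat.choose 3 2 = 3 := rfl
      omega
  have d1 := (Finset.card_le_card c1).trans (Finset.card_union_le _ _)
  have d2 : (M.biUnion Gm).card ≤ ∑ m ∈ M, (Gm m).card := Finset.card_biUnion_le
  have d3 := (Finset.card_le_card c2).trans Finset.card_biUnion_le
  have d4 : ∑ m ∈ M, ((Gm m).card + (Lm m).card) ≤ ∑ m ∈ M, max (R.card + 1) 4 := Finset.sum_le_sum bd
  rw [Finset.sum_add_distrib, Finset.sum_const, smul_eq_mul] at d4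
  omega

theorem mate1 {H : Finset (Finset ℕ)} (hU : Uni H) (hP : PF H) (hC : CF H) {v a b c d e f : ℕ}
    (hn : [v, a, b, c, d, e, f].Nodup) (h1 : Ed H v a b) (h2 : Ed H v c d) (h3 : Ed H v e f)
    {g : Finset ℕ} (hg : g ∈ H) (hv : v ∉ g) (ha : a ∈ g) : b ∈ g := by
  by_contra hb
  obtain ⟨s, t, k1, k2, k3, rfl⟩ := edge_through (hU g hg) ha
  simp at hn hv hb
  have q1 : s = c ∨ s = d ∨ t = c ∨ t = d := by
    by_contra hc
    exact hP s t a b v c d (by simp; grind) (Ed.r231 hg) h1.r231 h2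
  have q2 : s = e ∨ s = f ∨ t = e ∨ t = f := by
    by_contra hc
    exact hP s t a b v e f (by simp; grind) (Ed.r231 hg) h1.r231 h3
  have key : ∀ x y x', (x = c ∧ x' = d ∨ x = d ∧ x' = c) → (y = e ∨ y = f) → Ed H a y x → False := by
    rintro x y x' (⟨rfl, rfl⟩ | ⟨rfl, rfl⟩) (rfl | rfl) he
    · exact hC a y x x' v b (by simp; grind) he h2.r231 h1.r132
    · exact hC a y x x' v b (by simp; grind) he h2.r231 h1.r132
    · exact hC a y x x' v b (by simp; grind) he h2.r321 h1.r132
    · exact hC a y x x' v b (by simp; grind) he h2.r321 h1.r132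
  rcases q1 with h | h | h | h
  · exact key s t d (by grind) (by grind) (Ed.r132 hg)
  · exact key s t c (by grind) (by grind) (Ed.r132 hg)
  · exact key t s d (by grind) (by grind) hg
  · exact key t s c (by grind) (by grind) hg

theorem mate2 {H : Finset (Finset ℕ)} (hU : Uni H) (hP : PF H) (hC : CF H) {v a b c d e f : ℕ}
    (hn : [v, a, b, c, d, e, f].Nodup) (h1 : Ed H v a b) (h2 : Ed H v c d) (h3 : Ed H v e f)
    {g : Finset ℕ} (hg : g ∈ H) (hv : v ∉ g) {x y : ℕ} (hxy : Ed H v x y) (hx : x ∈ g) : y ∈ g := by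
  by_contra hy
  have m1 : a ∈ g → b ∈ g := mate1 hU hP hC hn h1 h2 h3 hg hv
  have m2 : b ∈ g → a ∈ g := mate1 hU hP hC (b := a) (by simp at hn ⊢; grind) h1.r132 h2 h3 hg hv
  have m3 : c ∈ g → d ∈ g := mate1 hU hP hC (by simp at hn ⊢; grind) h2 h1 h3 hg hv
  have m4 : d ∈ g → c ∈ g := mate1 hU hP hC (by simp at hn ⊢; grind) h2.r132 h1 h3 hg hv
  have m5 : e ∈ g → f ∈ g := mate1 hU hP hC (by simp at hn ⊢; grind) h3 h1 h2 hg hv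
  have m6 : f ∈ g → e ∈ g := mate1 hU hP hC (by simp at hn ⊢; grind) h3.r132 h1 h2 hg hv
  have hg3 := hU g hg
  have key : ∀ p q, Ed H v p q → (p ∈ g → q ∈ g) → (q ∈ g → p ∈ g) → y = p ∨ y = q ∨ (p ∈ g ∧ q ∈ g) := by
    intro p q hpq i1 i2
    by_contra! hc
    obtain ⟨yp, yq, hc⟩ := hc
    have hp : p ∉ g := fun h => hc h (i1 h)
    have hq : q ∉ g := fun h => hp (i2 h)
    obtain ⟨n1, n2, n3⟩ := hU.ne hpq
    obtain ⟨n4, n5, n6⟩ := hU.ne hxy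
    clear m1 m2 m3 m4 m5 m6 hn h1 h2 h3 i1 i2 hc
    obtain ⟨s, t, k1, k2, k3, rfl⟩ := edge_through hg3 hx
    simp only [Finset.mem_insert, Finset.mem_singleton, not_or] at hp hq hv hy
    refine hP s t x y v p q ?_ (Ed.r231 hg) hxy.r231 hpq
    simp only [List.nodup_cons, List.mem_cons, List.not_mem_nil, or_false, not_or, not_false_eq_true,
      List.nodup_nil, and_true]
    obtain ⟨hp1, hp2, hp3⟩ := hp
    obtain ⟨hq1, hq2, hq3⟩ := hq
    obtain ⟨hv1, hv2, hv3⟩ := hv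
    obtain ⟨hy1, hy2, hy3⟩ := hy
    refine ⟨⟨k3, ?_, ?_, ?_, ?_, ?_⟩, ⟨?_, ?_, ?_, ?_, ?_⟩, ⟨?_, ?_, ?_, ?_⟩, ⟨?_, ?_, ?_⟩, ⟨?_, ?_⟩, ?_⟩ <;>
      first | assumption | (apply Ne.symm; assumption)
  have four : ∀ p q r s, p ≠ q → p ≠ r → p ≠ s → q ≠ r → q ≠ s → r ≠ s →
      p ∈ g ∧ q ∈ g → r ∈ g ∧ s ∈ g → False := by
    intro p q r s j1 j2 j3 j4 j5 j6 hpq hrs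
    have h4 : ({p, q, r, s} : Finset ℕ).card = 4 := Finset.card_eq_four.2 ⟨p, q, r, s, j1, j2, j3, j4, j5, j6, rfl⟩
    have : ({p, q, r, s} : Finset ℕ) ⊆ g := by
      intro z hz
      simp only [Finset.mem_insert, Finset.mem_singleton] at hz
      rcases hz with rfl | rfl | rfl | rfl
      exacts [hpq.1, hpq.2, hrs.1, hrs.2]
    have := Finset.card_le_card this
    omega
  have p1 := key a b h1 m1 m2
  have p2 := key c d h2 m3 m4
  have p3 := key e f h3 m5 m6
  simp only [List.nodup_cons, List.mem_cons, List.not_mem_nil, or_false, not_or, not_false_eq_true,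
      List.nodup_nil, and_true] at hn
  obtain ⟨-, ⟨ab, ac, ad, ae, af⟩, ⟨bc, bd, be, bf⟩, ⟨cd, ce, cf⟩, ⟨de, df⟩, ef⟩ := hn
  have u1 := four a b c d ab ac ad bc bd cd
  have u2 := four a b e f ab ae af be bf ef
  have u3 := four c d e f cd ce cf de df ef
  clear key four m1 m2 m3 m4 m5 m6 hU hP hC h1 h2 h3 hxy hx hg hv hy
  rcases p1 with p1 | p1 | p1 <;> rcases p2 with p2 | p2 | p2 <;>
    first | exact u1 p1 p2 | (exfalso; subst p1; contradiction) | (rcases p3 with p3 | p3 | p3 <;> first | exact u2 p1 p3 | exact u3 p2 p3 | (exfalso; subst p1; contradiction) | (exfalso; subst p2; contradiction))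
end TF
namespace TF

theorem nu3 {H : Finset (Finset ℕ)} (hU : Uni H) (hP : PF H) (hC : CF H) {S : Finset ℕ}
    (hS : ∀ e ∈ H, e ⊆ S) {v a b c d e f : ℕ}
    (hn : [v, a, b, c, d, e, f].Nodup) (h1 : Ed H v a b) (h2 : Ed H v c d) (h3 : Ed H v e f) :
    v ∈ S ∧ ∃ Y ⊆ S.erase v, (∀ g ∈ H, v ∉ g → g ⊆ Y) ∧ (∀ g ∈ H, v ∈ g → g.erase v ⊆ Y ∨ Disjoint g Y) ∧
    (Y.card = 4 → (∃ g ∈ H, v ∈ g ∧ g.erase v ⊆ Y) → H.card ≤ ((S.erase v \ Y).card).choose 2 + 3) ∧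
    ∃ o p : ℕ, ∃ R : Finset ℕ, o = (S.erase v \ Y).card ∧ o + 2 * p + R.card + 1 = S.card ∧
      2 * p + R.card = Y.card ∧ 3 ≤ p + o / 2 ∧
      H.card ≤ o.choose 2 + p * max (R.card + 1) 4 + (H.filter (fun e => e ⊆ R)).card := by
  have hvS : v ∈ S := hS _ h1 (by simp)
  obtain ⟨G, hG⟩ : ∃ G, G = H.filter (fun g => v ∉ g) := ⟨_, rfl⟩
  have hGm : ∀ g, g ∈ G ↔ g ∈ H ∧ v ∉ g := by intro g; rw [hG, Finset.mem_filter]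
  obtain ⟨Y, hYe⟩ : ∃ Y : Finset ℕ, Y = G.biUnion id := ⟨_, rfl⟩
  have hYm : ∀ y, y ∈ Y ↔ ∃ g ∈ G, y ∈ g := by intro y; rw [hYe]; simp
  have hGY : ∀ g ∈ G, g ⊆ Y := fun g hg y hy => (hYm y).2 ⟨g, hg, hy⟩
  have hYS : Y ⊆ S.erase v := by
    intro y hy
    obtain ⟨g, hg, hyg⟩ := (hYm y).1 hy
    rw [hGm] at hg
    exact Finset.mem_erase.2 ⟨by rintro rfl; exact hg.2 hyg, hS g hg.1 hyg⟩
  obtain ⟨L, hL⟩ : ∃ L : Finset (Finset ℕ), L = (H.filter (fun g => v ∈ g)).image (fun g => g.erase v) := ⟨_, rfl⟩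
  have hLc : L.card = (H.filter (fun g => v ∈ g)).card := by
    rw [hL]
    apply Finset.card_image_of_injOn
    intro g hg g' hg' hgg
    have i1 : v ∈ g := by simp at hg; exact hg.2
    have i2 : v ∈ g' := by simp at hg'; exact hg'.2
    have hgg : g.erase v = g'.erase v := hgg
    rw [← Finset.insert_erase i1, ← Finset.insert_erase i2, hgg]
  have hHc : H.card = G.card + L.card := by
    rw [hLc, hG, add_comm]
    exact (Finset.card_filter_add_card_filter_not (fun g => v ∈ g)).symm
  have hLm : ∀ l ∈ L, ∃ x y, x ≠ y ∧ l = {x, y} ∧ Ed H v x y ∧ v ≠ x ∧ v ≠ y := by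
    intro l hl
    rw [hL, Finset.mem_image] at hl
    obtain ⟨g, hg, rfl⟩ := hl
    rw [Finset.mem_filter] at hg
    obtain ⟨x, y, k1, k2, k3, rfl⟩ := edge_through (hU g hg.1) hg.2
    exact ⟨x, y, k3, Finset.erase_insert (by simp; tauto), hg.1, k1, k2⟩
  have hLS : ∀ l ∈ L, l ⊆ S.erase v := by
    intro l hl
    rw [hL, Finset.mem_image] at hl
    obtain ⟨g, hg, rfl⟩ := hl
    rw [Finset.mem_filter] at hg
    exact Finset.erase_subset_erase _ (hS g hg.1)
  have hL2 : ∀ l ∈ L, l.card = 2 := by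
    intro l hl
    obtain ⟨x, y, hxy, rfl, -⟩ := hLm l hl
    exact Finset.card_pair hxy
  have hM : ∀ l ∈ L, ∀ g ∈ G, Disjoint l g ∨ l ⊆ g := by
    intro l hl g hg
    obtain ⟨x, y, hxy, rfl, he, -, -⟩ := hLm l hl
    rw [hGm] at hg
    have m1 : x ∈ g → y ∈ g := mate2 hU hP hC hn h1 h2 h3 hg.1 hg.2 he
    have m2 : y ∈ g → x ∈ g := mate2 hU hP hC hn h1 h2 h3 hg.1 hg.2 he.r132
    by_cases hx : x ∈ g
    · right
      intro z hz
      simp at hz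
      rcases hz with rfl | rfl
      · exact hx
      · exact m1 hx
    · left
      rw [Finset.disjoint_left]
      intro z hz hzg
      simp at hz
      rcases hz with rfl | rfl
      · exact hx hzg
      · exact hx (m2 hzg)
  have hLY : ∀ l ∈ L, l ⊆ Y ∨ Disjoint l Y := by
    intro l hl
    by_cases h : Disjoint l Y
    · exact Or.inr h
    · left
      obtain ⟨y, hyl, hyY⟩ := Finset.not_disjoint_iff.1 h
      obtain ⟨g, hg, hyg⟩ := (hYm y).1 hyY
      rcases hM l hl g hg with k | k
      · exact absurd hyg (Finset.disjoint_left.1 k hyl)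
      · exact k.trans (hGY g hg)
  have hvY : v ∉ Y := fun h => by have := hYS h; simp at this
  have hLmem : ∀ g ∈ H, v ∈ g → g.erase v ∈ L := by
    intro g hg hvg
    rw [hL]
    exact Finset.mem_image_of_mem (fun g : Finset ℕ => g.erase v) (Finset.mem_filter.2 ⟨hg, hvg⟩)
  obtain ⟨LO, hLO⟩ : ∃ LO, LO = L.filter (fun l => ¬ l ⊆ Y) := ⟨_, rfl⟩
  obtain ⟨LY, hLYe⟩ : ∃ LY, LY = L.filter (fun l => l ⊆ Y) := ⟨_, rfl⟩
  have hsplit : L.card = LY.card + LO.card := by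
    rw [hLO, hLYe]; exact (Finset.card_filter_add_card_filter_not _).symm
  have hOsub : ∀ l ∈ LO, l ⊆ S.erase v \ Y := by
    intro l hl
    rw [hLO, Finset.mem_filter] at hl
    intro z hz
    refine Finset.mem_sdiff.2 ⟨hLS l hl.1 hz, ?_⟩
    exact Finset.disjoint_left.1 ((hLY l hl.1).resolve_left hl.2) hz
  have hOc : LO.card ≤ ((S.erase v \ Y).card).choose 2 := by
    rw [← Finset.card_powersetCard]
    refine Finset.card_le_card fun l hl => Finset.mem_powersetCard.2 ⟨hOsub l hl, ?_⟩
    rw [hLO, Finset.mem_filter] at hl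
    exact hL2 l hl.1
  have hLYm : ∀ l ∈ LY, l ∈ L ∧ l ⊆ Y := by
    intro l hl; rwa [hLYe, Finset.mem_filter] at hl
  have hG3 : ∀ g ∈ G, g.card = 3 := fun g hg => hU g ((hGm g).1 hg).1
  refine ⟨hvS, Y, hYS, fun g hg hvg => hGY g ((hGm g).2 ⟨hg, hvg⟩), ?_, ?_, ?_⟩
  · intro g hg hvg
    rcases hLY _ (hLmem g hg hvg) with h | h
    · exact Or.inl h
    · right
      rw [← Finset.insert_erase hvg, Finset.disjoint_insert_left]
      exact ⟨hvY, h⟩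
  · rintro hY4 ⟨g0, hg0, hvg0, hgY⟩
    have hl := hLmem g0 hg0 hvg0
    generalize g0.erase v = l at hl hgY
    have hl2 := hL2 l hl
    have hlg : ∀ g ∈ G, l ⊆ g := by
      intro g hg
      rcases hM l hl g hg with h | h
      · have := Finset.card_le_card (Finset.union_subset hgY (hGY g hg))
        rw [Finset.card_union_of_disjoint h, hG3 g hg] at this
        omega
      · exact h
    have hG2 : G.card ≤ 2 := by
      have : G ⊆ (Y \ l).image (fun t => insert t l) := by
        intro g hg
        have k1 : (g \ l).card = 1 := by
          have := Finset.card_sdiff_add_card_eq_card (hlg g hg)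
          have := hG3 g hg
          omega
        obtain ⟨t, ht⟩ := Finset.card_eq_one.1 k1
        have htg : t ∈ g \ l := by rw [ht]; simp
        rw [Finset.mem_sdiff] at htg
        refine Finset.mem_image.2 ⟨t, Finset.mem_sdiff.2 ⟨hGY g hg htg.1, htg.2⟩, ?_⟩
        rw [Finset.insert_eq, ← ht, Finset.sdiff_union_of_subset (hlg g hg)]
      have := (Finset.card_le_card this).trans Finset.card_image_le
      have := Finset.card_sdiff_add_card_eq_card hgY
      omega
    have hex : ∃ g ∈ G, ∃ g' ∈ G, g ≠ g' := by
      by_contra! hc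
      have : Y.card ≤ 3 := by
        have hne : Y.Nonempty := Finset.card_pos.1 (by omega)
        obtain ⟨y, hy⟩ := hne
        obtain ⟨g, hg, -⟩ := (hYm y).1 hy
        rw [← hG3 g hg]
        apply Finset.card_le_card
        intro z hz
        obtain ⟨g', hg', hzg⟩ := (hYm z).1 hz
        rw [hc g hg g' hg']
        exact hzg
      omega
    obtain ⟨g, hg, g', hg', hne⟩ := hex
    have h5 : (g ∩ g').card ≤ 2 := by
      by_contra h6
      have h7 : g ∩ g' = g := Finset.eq_of_subset_of_card_le Finset.inter_subset_left (by
        have := hG3 g hg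
        omega)
      have h8 : g ∩ g' = g' := Finset.eq_of_subset_of_card_le Finset.inter_subset_right (by
        have := hG3 g' hg'
        omega)
      exact hne (h7.symm.trans h8)
    have hLY1 : LY.card ≤ 1 := by
      have key : ∀ l' ∈ LY, l' = g ∩ g' := by
        intro l' hl'
        obtain ⟨k1, k2⟩ := hLYm l' hl'
        have k3 := hL2 l' k1
        have hlg' : ∀ g ∈ G, l' ⊆ g := by
          intro g hg
          rcases hM l' k1 g hg with h | h
          · have := Finset.card_le_card (Finset.union_subset k2 (hGY g hg))
            rw [Finset.card_union_of_disjoint h, hG3 g hg] at this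
            omega
          · exact h
        exact Finset.eq_of_subset_of_card_le (Finset.subset_inter (hlg' g hg) (hlg' g' hg')) (by omega)
      exact Finset.card_le_one.2 fun p hp q hq => (key p hp).trans (key q hq).symm
    omega
  · obtain ⟨p, R, c1, c2, c3⟩ := link_count (G := G) (L := LY) (Y := Y) (fun g hg => ⟨hG3 g hg, hGY g hg⟩)
      (fun l hl => ⟨hL2 l (hLYm l hl).1, (hLYm l hl).2⟩) (fun y hy => (hYm y).1 hy)
      (fun l hl => hM l (hLYm l hl).1)
    have s1 := Finset.card_sdiff_add_card_eq_card hYS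
    have s2 := Finset.card_erase_add_one hvS
    have s3 : (G.filter (fun e => e ⊆ R)).card ≤ (H.filter (fun e => e ⊆ R)).card :=
      Finset.card_le_card (Finset.filter_subset_filter _ (by rw [hG]; exact Finset.filter_subset _ _))
    refine ⟨_, p, R, rfl, by omega, c1, ?_, by omega⟩
    -- the matching
    have mem : ∀ x y, Ed H v x y → ({x, y} : Finset ℕ) ∈ L := by
      intro x y h
      have h' := hLmem _ h (by simp)
      have hne := hU.ne h
      rwa [Finset.erase_insert (by simp; tauto)] at h'
    obtain ⟨N, hN⟩ : ∃ N : Finset (Finset ℕ), N = {{a, b}, {c, d}, {e, f}} := ⟨_, rfl⟩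
    simp at hn
    have dj : ∀ p q r s : ℕ, p ≠ r → p ≠ s → q ≠ r → q ≠ s → Disjoint ({p, q} : Finset ℕ) {r, s} := by
      intro p q r s k1 k2 k3 k4
      rw [Finset.disjoint_left]
      intro z
      simp
      rintro (rfl | rfl) <;> tauto
    have d1 := dj a b c d (by tauto) (by tauto) (by tauto) (by tauto)
    have d2 := dj a b e f (by tauto) (by tauto) (by tauto) (by tauto)
    have d3 := dj c d e f (by tauto) (by tauto) (by tauto) (by tauto)
    have ne : ∀ p q : ℕ, ∀ s : Finset ℕ, Disjoint ({p, q} : Finset ℕ) s → ({p, q} : Finset ℕ) ≠ s := by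
      rintro p q s h rfl
      rw [disjoint_self] at h
      simp at h
    have hNc : N.card = 3 := by
      rw [hN]
      exact Finset.card_eq_three.2 ⟨_, _, _, ne _ _ _ d1, ne _ _ _ d2, ne _ _ _ d3, rfl⟩
    have hNL : N ⊆ L := by
      rw [hN]
      intro l hl
      simp only [Finset.mem_insert, Finset.mem_singleton] at hl
      rcases hl with rfl | rfl | rfl
      · exact mem _ _ h1
      · exact mem _ _ h2
      · exact mem _ _ h3
    have hNd : (N : Set (Finset ℕ)).PairwiseDisjoint id := by
      intro l hl l' hl' hne
      simp only [hN, Finset.coe_insert, Finset.coe_singleton, Set.mem_insert_iff, Set.mem_singleton_iff] at hl hl'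
      simp only [Function.onFun, id]
      rcases hl with rfl | rfl | rfl <;> rcases hl' with rfl | rfl | rfl <;>
        first | exact absurd rfl hne | assumption | (apply Disjoint.symm; assumption)
    have n1 := c2 (N.filter (fun l => l ⊆ Y)) (by
      rw [hLYe]; exact Finset.filter_subset_filter _ hNL) (hNd.subset (by
        intro l hl; exact (Finset.mem_filter.1 hl).1))
    have n2 : 2 * (N.filter (fun l => ¬ l ⊆ Y)).card ≤ (S.erase v \ Y).card := by
      have hd : ((N.filter (fun l => ¬ l ⊆ Y) : Finset (Finset ℕ)) : Set (Finset ℕ)).PairwiseDisjoint id :=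
        hNd.subset (by intro l hl; exact (Finset.mem_filter.1 hl).1)
      have e1 : ((N.filter (fun l => ¬ l ⊆ Y)).biUnion id).card = 2 * (N.filter (fun l => ¬ l ⊆ Y)).card := by
        rw [Finset.card_biUnion hd, Finset.sum_const_nat (m := 2)]
        · ring
        · intro m hm; exact hL2 m (hNL (Finset.mem_filter.1 hm).1)
      rw [← e1]
      apply Finset.card_le_card
      rw [Finset.biUnion_subset]
      intro l hl
      apply hOsub
      rw [hLO, Finset.mem_filter]
      exact ⟨hNL (Finset.mem_filter.1 hl).1, (Finset.mem_filter.1 hl).2⟩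
    have n3 : (N.filter (fun l => l ⊆ Y)).card + (N.filter (fun l => ¬ l ⊆ Y)).card = N.card :=
      Finset.card_filter_add_card_filter_not _
    omega
end TF
namespace TF

theorem not_NF {H : Finset (Finset ℕ)} (h : ¬ NF H) : ∃ v a b c d e f : ℕ,
    [v, a, b, c, d, e, f].Nodup ∧ Ed H v a b ∧ Ed H v c d ∧ Ed H v e f := by
  unfold NF at h
  push Not at h
  simpa using h

theorem hbd {H : Finset (Finset ℕ)} (hU : Uni H) (hP : PF H) (hC : CF H) {S : Finset ℕ}
    (hS : ∀ e ∈ H, e ⊆ S) : (S.card ≤ 6 → H.card ≤ 13) ∧ (S.card ≤ 7 → H.card ≤ 15) := by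
  by_cases hN : NF H
  · have := q_small hU hP hC hN hS
    omega
  · obtain ⟨v, a, b, c, d, e, f, hn, h1, h2, h3⟩ := not_NF hN
    obtain ⟨hv, Y, hY, -, -, -, o, p, R, ho, k1, k2, k3, k4⟩ := nu3 hU hP hC hS hn h1 h2 h3
    have k5 := filt_choose hU R
    clear ho k2
    generalize (H.filter (fun e => e ⊆ R)).card = x at *
    generalize R.card = r at *
    refine ⟨fun h => by omega, fun h => ?_⟩
    have hr : r = 0 := by omega
    subst hr
    have : p ≤ 3 := by omega
    simp at k5
    obtain rfl : x = 0 := k5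
    interval_cases p
    · obtain rfl : o = 6 := by omega
      have : Nat.choose 6 2 = 15 := rfl
      omega
    · obtain rfl : o = 4 := by omega
      have : Nat.choose 4 2 = 6 := rfl
      omega
    · obtain rfl : o = 2 := by omega
      have : Nat.choose 2 2 = 1 := rfl
      omega
    · obtain rfl : o = 0 := by omega
      have : Nat.choose 0 2 = 0 := rfl
      omega

theorem star8 {H : Finset (Finset ℕ)} (hU : Uni H) (hP : PF H) (hC : CF H) {S : Finset ℕ}
    (hS : ∀ e ∈ H, e ⊆ S) (hc : S.card ≤ 8) (h16 : 16 ≤ H.card) : ∃ v ∈ S, ∀ e ∈ H, v ∈ e := by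
  by_cases hN : NF H
  · have := q_small hU hP hC hN hS
    omega
  · obtain ⟨v, a, b, c, d, e, f, hn, h1, h2, h3⟩ := not_NF hN
    obtain ⟨hv, Y, hY, hYg, -, -, o, p, R, ho, k1, k2, k3, k4⟩ := nu3 hU hP hC hS hn h1 h2 h3
    refine ⟨v, hv, ?_⟩
    by_contra! hg
    obtain ⟨g, hg, hvg⟩ := hg
    have k6 := Finset.card_le_card (hYg g hg hvg)
    rw [hU g hg] at k6
    have k5 := filt_choose hU R
    clear ho
    generalize (H.filter (fun e => e ⊆ R)).card = x at *
    generalize R.card = r at *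
    generalize H.card = m at *
    have hr : r ≤ 1 := by omega
    have hx : x = 0 := by
      rw [Nat.choose_eq_zero_of_lt (by omega)] at k5
      omega
    have e4 : max (r + 1) 4 = 4 := by omega
    rw [e4] at k4
    have ho : o ≤ 4 := by omega
    have c0 : Nat.choose 0 2 = 0 := rfl
    have c1 : Nat.choose 1 2 = 0 := rfl
    have c2 : Nat.choose 2 2 = 1 := rfl
    have c3 : Nat.choose 3 2 = 3 := rfl
    have c4 : Nat.choose 4 2 = 6 := rfl
    interval_cases o <;> omega

theorem arith14 (o p r x m : ℕ) (h1 : o + 2 * p + r = 13) (h2 : 5 ≤ 2 * p + r) (h3 : 3 ≤ p + o / 2)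
    (hm : m ≤ o.choose 2 + p * max (r + 1) 4 + x) (hx : x ≤ r.choose 3) (hx6 : r ≤ 6 → x ≤ 13)
    (hx7 : r ≤ 7 → x ≤ 15) : m ≤ 39 := by
  have hr : r ≤ 7 := by omega
  have hp : p ≤ 6 := by omega
  interval_cases r <;> interval_cases p <;> (try omega) <;>
    (obtain ⟨o', ho⟩ : ∃ o', o' = o := ⟨_, rfl⟩
     have ho8 : o ≤ 8 := by omega
     interval_cases o <;> simp [Nat.choose] at * <;> omega)

/-- the triangle-free case on 14 vertices -/
theorem cf14 {H : Finset (Finset ℕ)} (hU : Uni H) (hP : PF H) (hC : CF H) {S : Finset ℕ}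
    (hS : ∀ e ∈ H, e ⊆ S) (hc : S.card = 14) (h40 : 40 ≤ H.card) :
    (∃ v ∈ S, ∀ e ∈ H, v ∈ e) ∨
    (∃ v ∈ S, ∃ Y ⊆ S.erase v, Y.card = 3 ∧ ∀ e ∈ H, e = Y ∨ (v ∈ e ∧ (e.erase v ⊆ Y ∨ Disjoint e Y))) ∨
    (∃ v ∈ S, ∃ Y ⊆ S.erase v, Y.card = 4 ∧ ∀ e ∈ H, e ⊆ Y ∨ (v ∈ e ∧ Disjoint e Y)) := by
  by_cases hN : NF H
  · have := q14 hU hP hC hN hS hc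
    omega
  · obtain ⟨v, a, b, c, d, e, f, hn, h1, h2, h3⟩ := not_NF hN
    obtain ⟨hv, Y, hY, hYg, hYl, hY4, o, p, R, ho, k1, k2, k3, k4⟩ := nu3 hU hP hC hS hn h1 h2 h3
    by_cases hg : ∀ e ∈ H, v ∈ e
    · exact Or.inl ⟨v, hv, hg⟩
    push Not at hg
    obtain ⟨g, hg, hvg⟩ := hg
    have k6 := Finset.card_le_card (hYg g hg hvg)
    rw [hU g hg] at k6
    right
    by_cases c3 : Y.card = 3
    · left
      refine ⟨v, hv, Y, hY, c3, fun e he => ?_⟩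
      by_cases hve : v ∈ e
      · exact Or.inr ⟨hve, hYl e he hve⟩
      · left
        exact Finset.eq_of_subset_of_card_le (hYg e he hve) (by rw [c3, hU e he])
    by_cases c4 : Y.card = 4
    · right
      refine ⟨v, hv, Y, hY, c4, fun e he => ?_⟩
      by_cases hve : v ∈ e
      · right
        refine ⟨hve, (hYl e he hve).resolve_left fun hh => ?_⟩
        have := hY4 c4 ⟨e, he, hve, hh⟩
        have s1 := Finset.card_sdiff_add_card_eq_card hY
        have s2 := Finset.card_erase_add_one hv
        have s3 : (S.erase v \ Y).card = 9 := by omega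
        rw [s3] at this
        have : Nat.choose 9 2 = 36 := rfl
        omega
      · exact Or.inl (hYg e he hve)
    exfalso
    have k5 := filt_choose hU R
    have hsub : H.filter (fun e => e ⊆ R) ⊆ H := Finset.filter_subset _ _
    have k7 := hbd (hU.mono hsub) (hP.mono hsub) (hC.mono hsub) (S := R) (fun e he => (Finset.mem_filter.1 he).2)
    have := arith14 o p R.card _ H.card (by omega) (by omega) k3 k4 k5 k7.1 k7.2
    omega

/-- extremal structure on at most 8 vertices -/
theorem ex8 {H : Finset (Finset ℕ)} (hU : Uni H) (hP : PF H) {S : Finset ℕ}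
    (hS : ∀ e ∈ H, e ⊆ S) (hc : S.card ≤ 8) (h20 : 20 ≤ H.card) :
    (∃ v ∈ S, ∀ e ∈ H, v ∈ e) ∨ ∃ U ⊆ S, U.card = 6 ∧ ∀ e ∈ H, e ⊆ U := by
  by_cases hC : CF H
  · exact Or.inl (star8 hU hP hC hS hc (by omega))
  · right
    obtain ⟨x1, x2, x3, y1, y2, y3, ht⟩ := exists_tri hC
    obtain ⟨U, hUe⟩ : ∃ U : Finset ℕ, U = {x1, x2, x3, y1, y2, y3} := ⟨_, rfl⟩
    have hUc : U.card = 6 := by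
      have h := List.toFinset_card_of_nodup ht.nd
      have e : [x1, x2, x3, y1, y2, y3].toFinset = U := by rw [hUe]; ext; simp
      rw [← e, h]; rfl
    have hUS : U ⊆ S := by
      have i1 := hS _ ht.e1
      have i2 := hS _ ht.e2
      have i3 := hS _ ht.e3
      simp only [Finset.insert_subset_iff, Finset.singleton_subset_iff] at i1 i2 i3
      rw [hUe]
      simp only [Finset.insert_subset_iff, Finset.singleton_subset_iff]
      tauto
    have s1 := Finset.card_sdiff_add_card_eq_card hUS
    rcases ht.main hU hP hS hUe with h | ⟨W, hW, hWn, h⟩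
    · refine ⟨U, hUS, hUc, fun e he => (h e he).resolve_right fun hd => ?_⟩
      have : e ⊆ S \ U := fun z hz => Finset.mem_sdiff.2 ⟨hS e he hz, Finset.disjoint_left.1 hd hz⟩
      have := Finset.card_le_card this
      rw [hU e he] at this
      omega
    · exfalso
      have s2 := Finset.card_le_card hW
      have s3 := Finset.card_sdiff_add_card_eq_card hW
      have s4 := filt_choose hU ((S \ U) \ W)
      rw [Nat.choose_eq_zero_of_lt (by omega)] at s4
      omega

theorem tri_card {H : Finset (Finset ℕ)} {x1 x2 x3 y1 y2 y3 : ℕ} (ht : Tri H x1 x2 x3 y1 y2 y3)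
    {S : Finset ℕ} (hS : ∀ e ∈ H, e ⊆ S) :
    ({x1, x2, x3, y1, y2, y3} : Finset ℕ).card = 6 ∧ ({x1, x2, x3, y1, y2, y3} : Finset ℕ) ⊆ S := by
  constructor
  · have h := List.toFinset_card_of_nodup ht.nd
    have e : [x1, x2, x3, y1, y2, y3].toFinset = {x1, x2, x3, y1, y2, y3} := by ext; simp
    rw [← e, h]; rfl
  · have i1 := hS _ ht.e1
    have i2 := hS _ ht.e2
    have i3 := hS _ ht.e3
    simp only [Finset.insert_subset_iff, Finset.singleton_subset_iff] at i1 i2 i3 ⊢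
    tauto

theorem star_card {H : Finset (Finset ℕ)} (hU : Uni H) {S : Finset ℕ}
    (hS : ∀ e ∈ H, e ⊆ S) {v : ℕ} (hv : v ∈ S) (h : ∀ e ∈ H, v ∈ e) : H.card ≤ (S.card - 1).choose 2 := by
  rw [← Finset.card_erase_of_mem hv, ← Finset.card_powersetCard]
  apply Finset.card_le_card_of_injOn (fun e => e.erase v)
  · intro e he
    refine Finset.mem_coe.2 (Finset.mem_powersetCard.2 ⟨Finset.erase_subset_erase _ (hS e he), ?_⟩)
    rw [Finset.card_erase_of_mem (h e he), hU e he]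
  · intro g hg g' hg' hgg
    have hgg : g.erase v = g'.erase v := hgg
    rw [← Finset.insert_erase (h g hg), ← Finset.insert_erase (h g' hg'), hgg]

theorem ex7 {H : Finset (Finset ℕ)} (hU : Uni H) (hP : PF H) {S : Finset ℕ}
    (hS : ∀ e ∈ H, e ⊆ S) (hc : S.card ≤ 7) : H.card ≤ 20 := by
  by_contra hlt
  rcases ex8 hU hP hS (by omega) (by omega) with ⟨v, hv, h⟩ | ⟨U, hUS, hUc, h⟩
  · have h1 := star_card hU hS hv h
    have h2 := Nat.choose_le_choose 2 (show S.card - 1 ≤ 6 by omega)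
    have : Nat.choose 6 2 = 15 := rfl
    omega
  · have h1 := filter_card_le_choose hU h
    rw [hUc] at h1
    have : Nat.choose 6 3 = 20 := rfl
    omega

/-- upper bound, structural form -/
theorem upper {H : Finset (Finset ℕ)} (hU : Uni H) (hP : PF H) {S : Finset ℕ}
    (hS : ∀ e ∈ H, e ⊆ S) (hc : S.card = 14) (h40 : 40 ≤ H.card) :
    (∃ v ∈ S, ∀ e ∈ H, v ∈ e) ∨
    (∃ v ∈ S, ∃ Y ⊆ S.erase v, Y.card = 3 ∧ ∀ e ∈ H, e = Y ∨ (v ∈ e ∧ (e.erase v ⊆ Y ∨ Disjoint e Y))) ∨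
    (∃ v ∈ S, ∃ Y ⊆ S.erase v, Y.card = 4 ∧ ∀ e ∈ H, e ⊆ Y ∨ (v ∈ e ∧ Disjoint e Y)) ∨
    (∃ v ∈ S, ∃ Y ⊆ S.erase v, Y.card = 6 ∧ ∀ e ∈ H, e ⊆ Y ∨ (v ∈ e ∧ Disjoint e Y)) ∨
    (∃ U ⊆ S, U.card = 6 ∧ ∃ U' ⊆ S \ U, U'.card = 6 ∧ ∀ e ∈ H, e ⊆ U ∨ e ⊆ U') := by
  by_cases hC : CF H
  · rcases cf14 hU hP hC hS hc h40 with h | h | h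
    · exact Or.inl h
    · exact Or.inr (Or.inl h)
    · exact Or.inr (Or.inr (Or.inl h))
  · right; right; right
    obtain ⟨x1, x2, x3, y1, y2, y3, ht⟩ := exists_tri hC
    obtain ⟨hUc, hUS⟩ := tri_card ht hS
    obtain ⟨U, hUe⟩ : ∃ U : Finset ℕ, U = {x1, x2, x3, y1, y2, y3} := ⟨_, rfl⟩
    rw [← hUe] at hUc hUS
    have s1 := Finset.card_sdiff_add_card_eq_card hUS
    rcases ht.main hU hP hS hUe with h | ⟨W, hW, hWn, h⟩
    · have f1 := filt_choose hU U
      rw [hUc] at f1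
      have : Nat.choose 6 3 = 20 := rfl
      obtain ⟨K, hK⟩ : ∃ K, K = H.filter (fun e => ¬ e ⊆ U) := ⟨_, rfl⟩
      have f2 : (H.filter (fun e => e ⊆ U)).card + K.card = H.card := by
        rw [hK]; exact Finset.card_filter_add_card_filter_not _
      have hKm : ∀ e ∈ K, e ∈ H ∧ Disjoint e U := by
        intro e he
        rw [hK, Finset.mem_filter] at he
        exact ⟨he.1, (h e he.1).resolve_left he.2⟩
      have hKs : ∀ e ∈ K, e ⊆ S \ U := fun e he z hz =>
        Finset.mem_sdiff.2 ⟨hS e (hKm e he).1 hz, Finset.disjoint_left.1 (hKm e he).2 hz⟩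
      have hKH : K ⊆ H := fun e he => (hKm e he).1
      have hHK : ∀ e ∈ H, ¬ e ⊆ U → e ∈ K := by
        intro e he hh; rw [hK]; exact Finset.mem_filter.2 ⟨he, hh⟩
      rcases ex8 (hU.mono hKH) (hP.mono hKH) hKs (by omega) (by omega) with ⟨v, hv, hh⟩ | ⟨U', hU'S, hU'c, hh⟩
      · left
        rw [Finset.mem_sdiff] at hv
        refine ⟨v, hv.1, U, fun z hz => Finset.mem_erase.2 ⟨by rintro rfl; exact hv.2 hz, hUS hz⟩, hUc, fun e he => ?_⟩
        by_cases heU : e ⊆ U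
        · exact Or.inl heU
        · exact Or.inr ⟨hh e (hHK e he heU), (hKm e (hHK e he heU)).2⟩
      · right
        refine ⟨U, hUS, hUc, U', hU'S, hU'c, fun e he => ?_⟩
        by_cases heU : e ⊆ U
        · exact Or.inl heU
        · exact Or.inr (hh e (hHK e he heU))
    · exfalso
      have s2 := Finset.card_le_card hW
      have s3 := Finset.card_sdiff_add_card_eq_card hW
      have s4 := filt_choose hU ((S \ U) \ W)
      have s6 := hWn.card_pos
      have hsub : H.filter (fun e => e ⊆ ((S \ U) \ W)) ⊆ H := Finset.filter_subset _ _
      have s5 := ex7 (hU.mono hsub) (hP.mono hsub) (S := (S \ U) \ W) (fun e he => (Finset.mem_filter.1 he).2) (by omega)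
      generalize (H.filter (fun e => e ⊆ ((S \ U) \ W))).card = x at *
      generalize ((S \ U) \ W).card = y at *
      by_cases hw : W.card ≤ 2
      · omega
      · have hy : y ≤ 5 := by omega
        have c3 : Nat.choose 3 3 = 1 := rfl
        have c4 : Nat.choose 4 3 = 4 := rfl
        have c5 : Nat.choose 5 3 = 10 := rfl
        have c0 : Nat.choose 0 3 = 0 := rfl
        have c1 : Nat.choose 1 3 = 0 := rfl
        have c2 : Nat.choose 2 3 = 0 := rfl
        interval_cases y <;> omega
end TF
namespace TF

theorem glue1 {A A' : Finset ℕ} (h : A.card ≤ A'.card) : ∃ f : ℕ → ℕ, Set.InjOn f A ∧ ∀ x ∈ A, f x ∈ A' := by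
  obtain ⟨φ⟩ := Function.Embedding.nonempty_of_card_le (α := A) (β := A') (by simpa using h)
  refine ⟨fun x => if hx : x ∈ A then (φ ⟨x, hx⟩ : ℕ) else 0, ?_, ?_⟩
  · intro x hx y hy hxy
    have hx' : x ∈ A := hx
    have hy' : y ∈ A := hy
    simp only [hx', hy', dif_pos] at hxy
    have := φ.injective (Subtype.ext hxy)
    exact congrArg Subtype.val this
  · intro x hx
    simp only [hx, dif_pos]
    exact (φ ⟨x, hx⟩).2

theorem glue2 {A B A' B' : Finset ℕ} (hd' : Disjoint A' B') {f g : ℕ → ℕ}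
    (hf : Set.InjOn f A) (hf' : ∀ x ∈ A, f x ∈ A') (hg : Set.InjOn g B) (hg' : ∀ x ∈ B, g x ∈ B') (hd : Disjoint A B) :
    ∃ h : ℕ → ℕ, Set.InjOn h ((A ∪ B : Finset ℕ) : Set ℕ) ∧ (∀ x ∈ A, h x = f x) ∧ (∀ x ∈ B, h x = g x) := by
  have e1 : ∀ x ∈ A, (if x ∈ A then f x else g x) = f x := fun x hx => if_pos hx
  have e2 : ∀ x ∈ B, (if x ∈ A then f x else g x) = g x := fun x hx => if_neg (Finset.disjoint_right.1 hd hx)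
  refine ⟨fun x => if x ∈ A then f x else g x, ?_, e1, e2⟩
  intro x hx y hy hxy
  simp only at hxy
  rw [Finset.mem_coe, Finset.mem_union] at hx hy
  rcases hx with hx | hx <;> rcases hy with hy | hy
  · rw [e1 x hx, e1 y hy] at hxy; exact hf hx hy hxy
  · rw [e1 x hx, e2 y hy] at hxy
    exact absurd (hxy ▸ hf' x hx) (Finset.disjoint_right.1 hd' (hg' y hy))
  · rw [e2 x hx, e1 y hy] at hxy
    exact absurd (hxy ▸ hf' y hy) (Finset.disjoint_right.1 hd' (hxy ▸ hg' x hx))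
  · rw [e2 x hx, e2 y hy] at hxy; exact hg hx hy hxy

theorem glue3 {S A B A' B' C' : Finset ℕ} (hA : A ⊆ S) (hB : B ⊆ S) (hAB : Disjoint A B)
    (h1 : A.card ≤ A'.card) (h2 : B.card ≤ B'.card) (h3 : ((S \ A) \ B).card ≤ C'.card)
    (d1 : Disjoint A' B') (d2 : Disjoint (A' ∪ B') C') :
    ∃ f : ℕ → ℕ, Set.InjOn f (S : Set ℕ) ∧ (∀ x ∈ A, f x ∈ A') ∧ (∀ x ∈ B, f x ∈ B') ∧
      (∀ x ∈ S, x ∉ A → x ∉ B → f x ∈ C') := by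
  obtain ⟨f1, i1, j1⟩ := glue1 h1
  obtain ⟨f2, i2, j2⟩ := glue1 h2
  obtain ⟨f3, i3, j3⟩ := glue1 h3
  obtain ⟨f4, i4, j4, k4⟩ := glue2 d1 i1 j1 i2 j2 hAB
  have hS : (A ∪ B) ∪ ((S \ A) \ B) = S := by
    ext x
    simp only [Finset.mem_union, Finset.mem_sdiff]
    constructor
    · rintro ((h | h) | h)
      exacts [hA h, hB h, h.1.1]
    · tauto
  obtain ⟨f, i, j, k⟩ := glue2 d2 (A := A ∪ B) (B := (S \ A) \ B) (f := f4) (g := f3) i4 (by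
    intro x hx
    rcases Finset.mem_union.1 hx with hx | hx
    · rw [j4 x hx]; exact Finset.mem_union_left _ (j1 x hx)
    · rw [k4 x hx]; exact Finset.mem_union_right _ (j2 x hx)) i3 j3 (by
    rw [Finset.disjoint_left]
    intro x hx
    simp only [Finset.mem_union, Finset.mem_sdiff] at hx ⊢
    tauto)
  rw [hS] at i
  refine ⟨f, i, ?_, ?_, ?_⟩
  · intro x hx; rw [j x (Finset.mem_union_left _ hx), j4 x hx]; exact j1 x hx
  · intro x hx; rw [j x (Finset.mem_union_right _ hx), k4 x hx]; exact j2 x hx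
  · intro x hx hxA hxB
    have : x ∈ (S \ A) \ B := by simp only [Finset.mem_sdiff]; tauto
    rw [k x this]; exact j3 x this

theorem tgt_star : (∀ x ∈ Finset.range 14, x ∈ (SS 14).verts) ∧
    ∀ e ∈ (Finset.range 14).powersetCard 3, 0 ∈ e → e ∈ (SS 14).edges := by
  refine ⟨fun x hx => hx, fun e he h0 => Finset.mem_filter.2 ⟨he, h0⟩⟩

theorem tgt_comet : (∀ x ∈ Finset.range 14, x ∈ (comet 14).verts) ∧
    (∀ e ∈ ({0, 1, 2, 3} : Finset ℕ).powersetCard 3, e ∈ (comet 14).edges) ∧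
    ∀ e ∈ (insert 0 (Finset.Ico 4 14)).powersetCard 3, 0 ∈ e → e ∈ (comet 14).edges := by
  refine ⟨fun x hx => hx, fun e he => Finset.mem_union_left _ he,
    fun e he h0 => Finset.mem_union_right _ (Finset.mem_filter.2 ⟨he, h0⟩)⟩

theorem tgt_K6S8 : (∀ x ∈ Finset.range 14, x ∈ ((KK 6).dUnion (SS 8)).verts) ∧
    (∀ e ∈ (Finset.range 6).powersetCard 3, e ∈ ((KK 6).dUnion (SS 8)).edges) ∧
    ∀ e ∈ (Finset.Ico 6 14).powersetCard 3, 6 ∈ e → e ∈ ((KK 6).dUnion (SS 8)).edges := by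
  refine ⟨by decide +kernel, by decide +kernel, by decide +kernel⟩

theorem tgt_K4S10 : (∀ x ∈ Finset.range 14, x ∈ ((KK 4).dUnion (SS 10)).verts) ∧
    (∀ e ∈ (Finset.range 4).powersetCard 3, e ∈ ((KK 4).dUnion (SS 10)).edges) ∧
    ∀ e ∈ (Finset.Ico 4 14).powersetCard 3, 4 ∈ e → e ∈ ((KK 4).dUnion (SS 10)).edges := by
  refine ⟨by decide +kernel, by decide +kernel, by decide +kernel⟩

theorem tgt_K6K6 : (∀ x ∈ Finset.range 14, x ∈ ((((KK 6).dUnion (KK 6)).dUnion (KK 1)).dUnion (KK 1)).verts) ∧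
    (∀ e ∈ (Finset.range 6).powersetCard 3, e ∈ ((((KK 6).dUnion (KK 6)).dUnion (KK 1)).dUnion (KK 1)).edges) ∧
    ∀ e ∈ (Finset.Ico 6 12).powersetCard 3, e ∈ ((((KK 6).dUnion (KK 6)).dUnion (KK 1)).dUnion (KK 1)).edges := by
  refine ⟨by decide +kernel, by decide +kernel, by decide +kernel⟩

theorem img {H : Finset (Finset ℕ)} (hU : Uni H) {S : Finset ℕ} (hS : ∀ e ∈ H, e ⊆ S) {f : ℕ → ℕ}
    (hf : Set.InjOn f (S : Set ℕ)) {e : Finset ℕ} (he : e ∈ H) {T : Finset ℕ} (hT : ∀ x ∈ e, f x ∈ T) :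
    e.image f ∈ T.powersetCard 3 := by
  refine Finset.mem_powersetCard.2 ⟨?_, ?_⟩
  · intro y hy
    obtain ⟨x, hx, rfl⟩ := Finset.mem_image.1 hy
    exact hT x hx
  · rw [Finset.card_image_of_injOn (hf.mono (by exact_mod_cast hS e he)), hU e he]

theorem embed (H : ThreeGraph) (hV : H.IsValid) (hc : H.verts.card = 14) (hP : PF H.edges)
    (h40 : 40 ≤ H.edges.card) : ∃ G ∈ L14, G.ContainsCopy H := by
  have hU : Uni H.edges := fun e he => (hV e he).1
  have hS : ∀ e ∈ H.edges, e ⊆ H.verts := fun e he => (hV e he).2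
  obtain ⟨S, hSe⟩ : ∃ S, S = H.verts := ⟨_, rfl⟩
  rw [← hSe] at hc hS
  rcases upper hU hP hS hc h40 with ⟨v, hv, h⟩ | ⟨v, hv, Y, hY, hYc, h⟩ | ⟨v, hv, Y, hY, hYc, h⟩ |
    ⟨v, hv, Y, hY, hYc, h⟩ | ⟨U, hUS, hUc, U', hU', hU'c, h⟩
  · refine ⟨SS 14, by simp [L14], ?_⟩
    obtain ⟨f, i, a1, a2, a3⟩ := glue3 (S := S) (A := {v}) (B := ∅) (A' := {0}) (B' := ∅) (C' := Finset.Ico 1 14)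
      (by simpa using hv) (by simp) (by simp) (by simp) (by simp)
      (by simp [Finset.card_sdiff, hc, hv]) (by simp) (by decide)
    have fv : f v = 0 := by simpa using a1 v (by simp)
    have fS : ∀ x ∈ S, f x ∈ Finset.range 14 := by
      intro x hx
      by_cases hxv : x = v
      · rw [hxv, fv]; simp
      · have := a3 x hx (by simpa using hxv) (by simp)
        simp at this ⊢; omega
    refine ⟨f, hSe ▸ i, hSe ▸ fun x hx => tgt_star.1 _ (fS x hx), fun e he => ?_⟩
    refine tgt_star.2 _ (img hU hS i he fun x hx => fS x (hS e he hx)) ?_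
    exact Finset.mem_image.2 ⟨v, h e he, fv⟩
  · refine ⟨comet 14, by simp [L14], ?_⟩
    have hvY : v ∉ Y := fun hh => by have := hY hh; simp at this
    have hYS : Y ⊆ S := hY.trans (Finset.erase_subset _ _)
    have s1 := Finset.card_sdiff_add_card_eq_card hY
    have s2 := Finset.card_erase_add_one hv
    obtain ⟨f, i, a1, a2, a3⟩ := glue3 (S := S) (A := {v}) (B := Y) (A' := {0}) (B' := {1, 2, 3}) (C' := Finset.Ico 4 14)
      (by simpa using hv) hYS (by simpa using hvY) (by simp) (by rw [hYc]; decide)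
      (by rw [Finset.sdiff_singleton_eq_erase, Nat.card_Ico]; omega) (by decide) (by decide)
    have fv : f v = 0 := by simpa using a1 v (by simp)
    have fS : ∀ x ∈ S, f x ∈ Finset.range 14 := by
      intro x hx
      by_cases hxv : x = v
      · rw [hxv, fv]; simp
      · by_cases hxY : x ∈ Y
        · have := a2 x hxY
          simp at this ⊢; omega
        · have := a3 x hx (by simpa using hxv) hxY
          simp at this ⊢; omega
    refine ⟨f, hSe ▸ i, hSe ▸ fun x hx => tgt_comet.1 _ (fS x hx), fun e he => ?_⟩
    rcases h e he with h1 | ⟨h1, h2 | h2⟩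
    · refine tgt_comet.2.1 _ (img hU hS i he fun x hx => ?_)
      have := a2 x (h1 ▸ hx)
      simp at this ⊢; omega
    · refine tgt_comet.2.1 _ (img hU hS i he fun x hx => ?_)
      by_cases hxv : x = v
      · rw [hxv, fv]; simp
      · have := a2 x (h2 (Finset.mem_erase.2 ⟨hxv, hx⟩))
        simp at this ⊢; omega
    · refine tgt_comet.2.2 _ (img hU hS i he fun x hx => ?_) (Finset.mem_image.2 ⟨v, h1, fv⟩)
      by_cases hxv : x = v
      · rw [hxv, fv]; simp
      · exact Finset.mem_insert_of_mem (a3 x (hS e he hx) (by simpa using hxv) (Finset.disjoint_left.1 h2 hx))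
  · refine ⟨(KK 4).dUnion (SS 10), by simp [L14], ?_⟩
    have hvY : v ∉ Y := fun hh => by have := hY hh; simp at this
    have hYS : Y ⊆ S := hY.trans (Finset.erase_subset _ _)
    have s1 := Finset.card_sdiff_add_card_eq_card hY
    have s2 := Finset.card_erase_add_one hv
    obtain ⟨f, i, a1, a2, a3⟩ := glue3 (S := S) (A := {v}) (B := Y) (A' := {4}) (B' := Finset.range 4) (C' := Finset.Ico 5 14)
      (by simpa using hv) hYS (by simpa using hvY) (by simp) (by rw [hYc]; decide)
      (by rw [Finset.sdiff_singleton_eq_erase, Nat.card_Ico]; omega) (by decide) (by decide)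
    have fv : f v = 4 := by simpa using a1 v (by simp)
    have fS : ∀ x ∈ S, f x ∈ Finset.range 14 := by
      intro x hx
      by_cases hxv : x = v
      · rw [hxv, fv]; simp
      · by_cases hxY : x ∈ Y
        · have := a2 x hxY
          simp at this ⊢; omega
        · have := a3 x hx (by simpa using hxv) hxY
          simp at this ⊢; omega
    refine ⟨f, hSe ▸ i, hSe ▸ fun x hx => tgt_K4S10.1 _ (fS x hx), fun e he => ?_⟩
    rcases h e he with h1 | ⟨h1, h2⟩
    · exact tgt_K4S10.2.1 _ (img hU hS i he fun x hx => a2 x (h1 hx))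
    · refine tgt_K4S10.2.2 _ (img hU hS i he fun x hx => ?_) (Finset.mem_image.2 ⟨v, h1, fv⟩)
      by_cases hxv : x = v
      · rw [hxv, fv]; simp
      · have := a3 x (hS e he hx) (by simpa using hxv) (Finset.disjoint_left.1 h2 hx)
        simp at this ⊢; omega
  · refine ⟨(KK 6).dUnion (SS 8), by simp [L14], ?_⟩
    have hvY : v ∉ Y := fun hh => by have := hY hh; simp at this
    have hYS : Y ⊆ S := hY.trans (Finset.erase_subset _ _)
    have s1 := Finset.card_sdiff_add_card_eq_card hY
    have s2 := Finset.card_erase_add_one hv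
    obtain ⟨f, i, a1, a2, a3⟩ := glue3 (S := S) (A := {v}) (B := Y) (A' := {6}) (B' := Finset.range 6) (C' := Finset.Ico 7 14)
      (by simpa using hv) hYS (by simpa using hvY) (by simp) (by rw [hYc]; decide)
      (by rw [Finset.sdiff_singleton_eq_erase, Nat.card_Ico]; omega) (by decide) (by decide)
    have fv : f v = 6 := by simpa using a1 v (by simp)
    have fS : ∀ x ∈ S, f x ∈ Finset.range 14 := by
      intro x hx
      by_cases hxv : x = v
      · rw [hxv, fv]; simp
      · by_cases hxY : x ∈ Y
        · have := a2 x hxY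
          simp at this ⊢; omega
        · have := a3 x hx (by simpa using hxv) hxY
          simp at this ⊢; omega
    refine ⟨f, hSe ▸ i, hSe ▸ fun x hx => tgt_K6S8.1 _ (fS x hx), fun e he => ?_⟩
    rcases h e he with h1 | ⟨h1, h2⟩
    · exact tgt_K6S8.2.1 _ (img hU hS i he fun x hx => a2 x (h1 hx))
    · refine tgt_K6S8.2.2 _ (img hU hS i he fun x hx => ?_) (Finset.mem_image.2 ⟨v, h1, fv⟩)
      by_cases hxv : x = v
      · rw [hxv, fv]; simp
      · have := a3 x (hS e he hx) (by simpa using hxv) (Finset.disjoint_left.1 h2 hx)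
        simp at this ⊢; omega
  · refine ⟨(((KK 6).dUnion (KK 6)).dUnion (KK 1)).dUnion (KK 1), by simp [L14], ?_⟩
    have s1 := Finset.card_sdiff_add_card_eq_card hUS
    have s2 := Finset.card_sdiff_add_card_eq_card hU'
    obtain ⟨f, i, a1, a2, a3⟩ := glue3 (S := S) (A := U) (B := U') (A' := Finset.range 6) (B' := Finset.Ico 6 12)
      (C' := Finset.Ico 12 14) hUS (hU'.trans Finset.sdiff_subset)
      (Finset.disjoint_right.2 fun x hx => (Finset.mem_sdiff.1 (hU' hx)).2)
      (by rw [hUc]; decide) (by rw [hU'c]; decide)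
      (by rw [Nat.card_Ico]; omega) (by decide) (by decide)
    have fS : ∀ x ∈ S, f x ∈ Finset.range 14 := by
      intro x hx
      by_cases hxv : x ∈ U
      · have := a1 x hxv
        simp at this ⊢; omega
      · by_cases hxY : x ∈ U'
        · have := a2 x hxY
          simp at this ⊢; omega
        · have := a3 x hx hxv hxY
          simp at this ⊢; omega
    refine ⟨f, hSe ▸ i, hSe ▸ fun x hx => tgt_K6K6.1 _ (fS x hx), fun e he => ?_⟩
    rcases h e he with h1 | h1
    · exact tgt_K6K6.2.1 _ (img hU hS i he fun x hx => a1 x (h1 hx))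
    · exact tgt_K6K6.2.2 _ (img hU hS i he fun x hx => a2 x (h1 hx))

theorem PF_of_free (H : ThreeGraph) (hV : H.IsValid) (hF : H.Free pathP) : PF H.edges := by
  intro a b c d e f g hn h1 h2 h3
  apply hF
  obtain ⟨φ, hφ⟩ : ∃ φ : ℕ → ℕ, φ = fun n => [a, b, c, d, e, f, g].getD n 0 := ⟨_, rfl⟩
  have v0 : φ 0 = a := by rw [hφ]; rfl
  have v1 : φ 1 = b := by rw [hφ]; rfl
  have v2 : φ 2 = c := by rw [hφ]; rfl
  have v3 : φ 3 = d := by rw [hφ]; rfl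
  have v4 : φ 4 = e := by rw [hφ]; rfl
  have v5 : φ 5 = f := by rw [hφ]; rfl
  have v6 : φ 6 = g := by rw [hφ]; rfl
  refine ⟨φ, ?_, ?_, ?_⟩
  · intro i hi j hj hij
    have hi' : i < [a, b, c, d, e, f, g].length := by
      have : i ∈ ({0,1,2,3,4,5,6} : Finset ℕ) := hi
      simp at this ⊢; omega
    have hj' : j < [a, b, c, d, e, f, g].length := by
      have : j ∈ ({0,1,2,3,4,5,6} : Finset ℕ) := hj
      simp at this ⊢; omega
    rw [hφ] at hij
    simp only at hij
    rw [List.getD_eq_getElem _ _ hi', List.getD_eq_getElem _ _ hj'] at hij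
    exact (hn.getElem_inj_iff).1 hij
  · intro v hv
    have hv : v ∈ ({0,1,2,3,4,5,6} : Finset ℕ) := hv
    have i1 := (hV _ h1).2
    have i2 := (hV _ h2).2
    have i3 := (hV _ h3).2
    simp only [Finset.mem_insert, Finset.mem_singleton] at hv
    rcases hv with rfl | rfl | rfl | rfl | rfl | rfl | rfl
    · rw [v0]; exact i1 (by simp)
    · rw [v1]; exact i1 (by simp)
    · rw [v2]; exact i1 (by simp)
    · rw [v3]; exact i2 (by simp)
    · rw [v4]; exact i2 (by simp)
    · rw [v5]; exact i3 (by simp)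
    · rw [v6]; exact i3 (by simp)
  · intro s hs
    have hs : s ∈ ({{0,1,2},{2,3,4},{4,5,6}} : Finset (Finset ℕ)) := hs
    simp only [Finset.mem_insert, Finset.mem_singleton] at hs
    rcases hs with rfl | rfl | rfl
    · simp only [Finset.image_insert, Finset.image_singleton, v0, v1, v2]; exact h1
    · simp only [Finset.image_insert, Finset.image_singleton, v2, v3, v4]; exact h2
    · simp only [Finset.image_insert, Finset.image_singleton, v4, v5, v6]; exact h3

/-- the extremal example -/
def rocket : ThreeGraph :=
  ⟨Finset.range 14, ((Finset.range 10).powersetCard 3).filter (fun e => 0 ∈ e) ∪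
    {{0, 10, 11}, {10, 11, 12}, {10, 11, 13}}⟩

theorem rocket_valid : rocket.IsValid := by
  unfold ThreeGraph.IsValid; decide +kernel

theorem rocket_card : rocket.edges.card = 39 := by decide +kernel

theorem rocket_inter : ∀ e ∈ rocket.edges, ∀ e' ∈ rocket.edges, 0 ∉ e → (e ∩ e').card ≠ 1 := by
  decide +kernel

theorem rocket_free : rocket.Free pathP := by
  rintro ⟨f, hi, hv, he⟩
  have hi : Set.InjOn f (({0,1,2,3,4,5,6} : Finset ℕ) : Set ℕ) := hi
  have m1 := he {0,1,2} (by decide)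
  have m2 := he {2,3,4} (by decide)
  have m3 := he {4,5,6} (by decide)
  have s1 : ({0,1,2} : Finset ℕ) ⊆ {0,1,2,3,4,5,6} := by decide
  have s2 : ({2,3,4} : Finset ℕ) ⊆ {0,1,2,3,4,5,6} := by decide
  have s3 : ({4,5,6} : Finset ℕ) ⊆ {0,1,2,3,4,5,6} := by decide
  have key : ∀ A B : Finset ℕ, A ⊆ {0,1,2,3,4,5,6} → B ⊆ {0,1,2,3,4,5,6} →
      (A.image f ∩ B.image f) = (A ∩ B).image f ∧ (A.image f ∩ B.image f).card = (A ∩ B).card := by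
    intro A B hA hB
    have e1 : A.image f ∩ B.image f = (A ∩ B).image f := by
      symm
      apply Finset.image_inter_of_injOn
      apply hi.mono
      rw [← Finset.coe_union]
      exact_mod_cast Finset.union_subset hA hB
    refine ⟨e1, ?_⟩
    rw [e1]
    apply Finset.card_image_of_injOn
    apply hi.mono
    exact_mod_cast Finset.inter_subset_left.trans hA
  by_cases z1 : 0 ∈ Finset.image f {0,1,2}
  · by_cases z3 : 0 ∈ Finset.image f {4,5,6}
    · have h0 := Finset.mem_inter.2 ⟨z1, z3⟩
      have h1 := (key _ _ s1 s3).2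
      have : (({0,1,2} : Finset ℕ) ∩ {4,5,6}).card = 0 := by decide
      rw [this, Finset.card_eq_zero] at h1
      rw [h1] at h0
      simp at h0
    · refine rocket_inter _ m3 _ m2 z3 ?_
      rw [(key _ _ s3 s2).2]; decide
  · refine rocket_inter _ m1 _ m2 z1 ?_
    rw [(key _ _ s1 s2).2]; decide

theorem rocket_star : ¬ (SS 14).ContainsCopy rocket := by
  rintro ⟨f, hi, hv, he⟩
  have m1 := (Finset.mem_filter.1 (he {0,1,2} (by decide +kernel))).2
  have m2 := (Finset.mem_filter.1 (he {10,11,12} (by decide +kernel))).2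
  obtain ⟨i, hi1, hi2⟩ := Finset.mem_image.1 m1
  obtain ⟨j, hj1, hj2⟩ := Finset.mem_image.1 m2
  simp only [Finset.mem_insert, Finset.mem_singleton] at hi1 hj1
  have hir : i ∈ Finset.range 14 := by simp; omega
  have hjr : j ∈ Finset.range 14 := by simp; omega
  have := hi hir hjr (hi2.trans hj2.symm)
  omega

theorem comet_edges : ∀ e ∈ (comet 14).edges, 0 ∈ e ∨ e = {1,2,3} := by decide +kernel

theorem rocket_comet : ¬ (comet 14).ContainsCopy rocket := by
  rintro ⟨f, hi, hv, he⟩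
  have hi : Set.InjOn f ((Finset.range 14 : Finset ℕ) : Set ℕ) := hi
  have pair : ∀ A B : Finset ℕ, A ∈ rocket.edges → B ∈ rocket.edges → A ⊆ Finset.range 14 → B ⊆ Finset.range 14 →
      A ≠ B → ∃ i ∈ A ∪ B, f i = 0 := by
    intro A B hA hB hA' hB' hne
    rcases comet_edges _ (he A hA) with h | h
    · obtain ⟨i, h1, h2⟩ := Finset.mem_image.1 h
      exact ⟨i, Finset.mem_union_left _ h1, h2⟩
    · rcases comet_edges _ (he B hB) with h' | h'
      · obtain ⟨i, h1, h2⟩ := Finset.mem_image.1 h'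
        exact ⟨i, Finset.mem_union_right _ h1, h2⟩
      · exfalso
        apply hne
        have hh := h.trans h'.symm
        ext x
        constructor
        · intro hx
          have := Finset.mem_image_of_mem f hx
          rw [hh] at this
          obtain ⟨y, hy, hxy⟩ := Finset.mem_image.1 this
          rw [← hi (hB' hy) (hA' hx) hxy]; exact hy
        · intro hx
          have := Finset.mem_image_of_mem f hx
          rw [← hh] at this
          obtain ⟨y, hy, hxy⟩ := Finset.mem_image.1 this
          rw [← hi (hA' hy) (hB' hx) hxy]; exact hy
  obtain ⟨i, hi1, hi2⟩ := pair {0,1,2} {0,3,4} (by decide +kernel) (by decide +kernel) (by decide) (by decide) (by decide)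
  obtain ⟨j, hj1, hj2⟩ := pair {10,11,12} {10,11,13} (by decide +kernel) (by decide +kernel) (by decide) (by decide) (by decide)
  simp only [Finset.mem_union, Finset.mem_insert, Finset.mem_singleton] at hi1 hj1
  have hir : i ∈ Finset.range 14 := by simp; omega
  have hjr : j ∈ Finset.range 14 := by simp; omega
  have := hi hir hjr (hi2.trans hj2.symm)
  omega

theorem rocket_disc (G : ThreeGraph) (A : Finset ℕ) (hA : A.card ≤ 13) (hB : (G.verts \ A).card ≤ 13)
    (hG : ∀ e ∈ G.edges, e ⊆ A ∨ Disjoint e A) : ¬ G.ContainsCopy rocket := by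
  rintro ⟨f, hi, hv, he⟩
  have hi : Set.InjOn f ((Finset.range 14 : Finset ℕ) : Set ℕ) := hi
  have step : ∀ e ∈ rocket.edges, ∀ x ∈ e, ∀ y ∈ e, (f x ∈ A ↔ f y ∈ A) := by
    intro e hee x hx y hy
    have hx' := Finset.mem_image_of_mem f hx
    have hy' := Finset.mem_image_of_mem f hy
    rcases hG _ (he e hee) with h | h
    · exact ⟨fun _ => h hy', fun _ => h hx'⟩
    · exact ⟨fun hh => absurd hh (Finset.disjoint_left.1 h hx'), fun hh => absurd hh (Finset.disjoint_left.1 h hy')⟩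
  have conn1 : ∀ x ∈ Finset.range 12, ∃ e ∈ rocket.edges, 0 ∈ e ∧ x ∈ e := by decide +kernel
  have conn2 : ∀ x ∈ Finset.Ico 12 14, ∃ e ∈ rocket.edges, 10 ∈ e ∧ x ∈ e := by decide +kernel
  have a1 : ∀ x ∈ Finset.range 12, (f x ∈ A ↔ f 0 ∈ A) := by
    intro x hx
    obtain ⟨e, hee, h0, hx⟩ := conn1 x hx
    exact step e hee x hx 0 h0
  have a2 : ∀ x ∈ Finset.range 14, (f x ∈ A ↔ f 0 ∈ A) := by
    intro x hx
    by_cases h : x < 12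
    · exact a1 x (by simpa using h)
    · obtain ⟨e, hee, h0, hx⟩ := conn2 x (by simp at hx ⊢; omega)
      exact (step e hee x hx 10 h0).trans (a1 10 (by simp))
  have hc : ((Finset.range 14).image f).card = 14 := by
    rw [Finset.card_image_of_injOn hi]; simp
  by_cases h0 : f 0 ∈ A
  · have : (Finset.range 14).image f ⊆ A := by
      intro y hy
      obtain ⟨x, hx, rfl⟩ := Finset.mem_image.1 hy
      exact (a2 x hx).2 h0
    have := Finset.card_le_card this
    omega
  · have : (Finset.range 14).image f ⊆ G.verts \ A := by
      intro y hy
      obtain ⟨x, hx, rfl⟩ := Finset.mem_image.1 hy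
      exact Finset.mem_sdiff.2 ⟨hv x hx, fun h => h0 ((a2 x hx).1 h)⟩
    have := Finset.card_le_card this
    omega
end TF

/-- The maximum number of edges of a `P`-free 3-graph on 14 vertices not contained
in any member of `L₁₄` equals 39. -/
theorem fifth_order_turan_fourteen :
    IsGreatest {m : ℕ | ∃ H : ThreeGraph, H.IsValid ∧ H.verts.card = 14 ∧
      H.Free pathP ∧ (∀ G ∈ L14, ¬ G.ContainsCopy H) ∧ H.edges.card = m} 39 := by
  constructor
  · refine ⟨TF.rocket, TF.rocket_valid, by decide, TF.rocket_free, ?_, TF.rocket_card⟩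
    intro G hG
    simp only [L14, List.mem_cons, List.not_mem_nil, or_false] at hG
    rcases hG with rfl | rfl | rfl | rfl | rfl
    · exact TF.rocket_star
    · exact TF.rocket_comet
    · exact TF.rocket_disc _ (Finset.range 6) (by decide) (by decide +kernel) (by decide +kernel)
    · exact TF.rocket_disc _ (Finset.range 6) (by decide) (by decide +kernel) (by decide +kernel)
    · exact TF.rocket_disc _ (Finset.range 4) (by decide) (by decide +kernel) (by decide +kernel)
  · rintro m ⟨H, hV, hc, hF, hL, rfl⟩
    by_contra hlt
    obtain ⟨G, hG, hGH⟩ := TF.embed H hV hc (TF.PF_of_free H hV hF) (by omega)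
    exact hL G hG hGH
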